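/- arXiv:1605.06701 — 4 statements merged into one kernel-verified Lean document; each statement's English description precedes it below -/
import Mathlib

section
/- Let r ≥ 2 be an integer, p ≥ r a prime, and F a hypergraph with n vertices. Then for any proper coloring c of the Kneser hypergraph KG^r(F) (with an arbitrary number of colors), there exist pairwise disjoint subsets U_1, …, U_p of V(KG^r(F)) spanning a complete r-uniform p-partite subhypergraph of KG^r(F) that is balanced and colorful with respect to c, and with |U_1| + ⋯ + |U_p| ≥ n − alt_p(F). -/
/-- `X` has an alternating subsequence of length `m`. -/
def HasAltSeq {n p : ℕ} (X : Fin n → Option (ZMod p)) (m : ℕ) : Prop :=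
  ∃ s : Fin m → Fin n, StrictMono s ∧ (∀ j, X (s j) ≠ none) ∧
    ∀ (j : ℕ) (h : j + 1 < m), X (s ⟨j, by omega⟩) ≠ X (s ⟨j + 1, h⟩)

/-- `alt(X)`: the maximum length of an alternating subsequence of `X`. -/
noncomputable def altVec {n p : ℕ} (X : Fin n → Option (ZMod p)) : ℕ :=
  sSup {m | HasAltSeq X m}

/-- `alt_p(F, σ)`. -/
noncomputable def altSigma {V : Type*} {n : ℕ} (E : Set (Finset V)) (p : ℕ)
    (σ : Fin n ≃ V) : ℕ :=
  sSup {a | ∃ X : Fin n → Option (ZMod p), a = altVec X ∧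
    ∀ ε : ZMod p, ∀ e ∈ E, ¬ ((e : Set V) ⊆ σ '' {i | X i = some ε})}

/-- `alt_p(F)`: the minimum of `alt_p(F, σ)` over all bijections `σ`. -/
noncomputable def altHyp {V : Type*} [Fintype V] (E : Set (Finset V)) (p : ℕ) : ℕ :=
  sInf {a | ∃ σ : Fin (Fintype.card V) ≃ V, a = altSigma E p σ}

/-- Edges of the Kneser hypergraph `KG^r(F)`. -/
def KGEdges {V : Type*} (E : Set (Finset V)) (r : ℕ) :
    Set (Finset {e : Finset V // e ∈ E}) :=
  {S | S.card = r ∧ ∀ e ∈ S, ∀ f ∈ S, e ≠ f → Disjoint e.1 f.1}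

/-- The sets `U i` span a complete `r`-uniform `p`-partite subhypergraph. -/
def SpansComplete {W : Type*} [DecidableEq W] (Eh : Set (Finset W)) (r : ℕ) {p : ℕ}
    (U : ZMod p → Finset W) : Prop :=
  ∀ T : Finset W, T.card = r → (∀ v ∈ T, ∃ i, v ∈ U i) →
    (∀ i, (T ∩ U i).card ≤ 1) → T ∈ Eh

set_option linter.unusedSectionVars false

namespace CSK

section ops
variable (p : ℕ) [Fact p.Prime]

abbrev M := ZMod p → ZMod p

def T (g : ZMod p) : M p →ₗ[ZMod p] M p where
  toFun x := fun i => x (i - g)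
  map_add' _ _ := rfl
  map_smul' _ _ := rfl

def N : M p →ₗ[ZMod p] M p where
  toFun x := fun _ => ∑ j, x j
  map_add' x y := by ext; simp [Finset.sum_add_distrib]
  map_smul' c x := by ext; simp [Finset.mul_sum]

def A (a : ZMod p) : M p →ₗ[ZMod p] M p where
  toFun x := fun i => ∑ j, (if (i - a).val < (j - a).val then 1 else 0) * x j
  map_add' x y := by ext; simp [Finset.sum_add_distrib, mul_add]
  map_smul' c x := by
    ext; simp only [Pi.smul_apply, smul_eq_mul, RingHom.id_apply, Finset.mul_sum]
    exact Finset.sum_congr rfl fun _ _ => by ring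

def B (a : ZMod p) : M p →ₗ[ZMod p] M p where
  toFun x := fun i => if i = a then x (a - 1) else 0
  map_add' x y := by ext i; by_cases h : i = a <;> simp [h]
  map_smul' c x := by ext i; by_cases h : i = a <;> simp [h]

def D : M p →ₗ[ZMod p] M p := T p 1 - LinearMap.id

variable {p}

lemma val_step (x : ZMod p) (h : x ≠ -1) : (x + 1).val = x.val + 1 := by
  have hp1 : 1 < p := (Fact.out : p.Prime).one_lt
  have : Fact (1 < p) := ⟨hp1⟩
  have h1 : (1 : ZMod p).val = 1 := ZMod.val_one p
  rw [← h1, ZMod.val_add_of_lt, h1]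
  rw [h1]
  have := ZMod.val_lt x
  rcases Nat.lt_or_ge (x.val + 1) p with h2 | h2
  · exact h2
  exfalso; apply h
  have h3 : x.val + 1 = p := by omega
  have : ((x.val + 1 : ℕ) : ZMod p) = 0 := by rw [h3]; simp
  push_cast at this
  rw [ZMod.natCast_zmod_val] at this
  exact eq_neg_of_add_eq_zero_left this

lemma val_m1 : (-1 : ZMod p).val = p - 1 := by
  obtain ⟨q, rfl⟩ : ∃ q, p = q + 1 := ⟨p - 1, by have := (Fact.out : p.Prime).pos; omega⟩
  exact ZMod.val_neg_one q

lemma idOdd (a : ZMod p) (x : M p) : D p (A p a x) + B p a (N p x) = x := by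
  ext i
  have hs : (D p (A p a x)) i = ∑ j, ((if (i - 1 - a).val < (j - a).val then 1 else 0) -
      (if (i - a).val < (j - a).val then 1 else 0)) * x j := by
    simp only [D, T, A, LinearMap.sub_apply, LinearMap.coe_mk, AddHom.coe_mk, LinearMap.id_apply,
      Pi.sub_apply, ← Finset.sum_sub_distrib, sub_mul]
  rw [Pi.add_apply, hs]
  by_cases h : i = a
  · subst h
    simp only [B, N, LinearMap.coe_mk, AddHom.coe_mk, if_true, ← Finset.sum_add_distrib]
    rw [Finset.sum_eq_single i]
    · simp
    · intro j _ hj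
      have h0 : 0 < (j - i).val := by
        rw [Nat.pos_iff_ne_zero, Ne, ZMod.val_eq_zero, sub_eq_zero]; exact hj
      have h1 : ¬ ((i - 1 - i).val < (j - i).val) := by
        rw [show i - 1 - i = -1 by ring, val_m1]
        have := ZMod.val_lt (j - i); omega
      rw [if_neg h1, sub_self, if_pos (by simpa using h0)]; ring
    · simp
  · have h2 : (B p a (N p x)) i = 0 := by simp [B, h]
    rw [h2, add_zero, Finset.sum_eq_single i]
    · have : (i - 1 - a).val < (i - a).val := by
        have := val_step (i - 1 - a) (by intro h3; apply h; linear_combination h3)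
        rw [show i - 1 - a + 1 = i - a by ring] at this
        omega
      simp [this]
    · intro j _ hj
      have h3 := val_step (i - 1 - a) (by intro h3; apply h; linear_combination h3)
      rw [show i - 1 - a + 1 = i - a by ring] at h3
      have h4 : (i - a).val ≠ (j - a).val := by
        intro h5; apply hj; have := ZMod.val_injective p h5
        linear_combination -this
      have : ((i - 1 - a).val < (j - a).val) ↔ ((i - a).val < (j - a).val) := by omega
      simp [this]
    · simp

lemma idEven (a : ZMod p) (x : M p) : N p (B p a x) + A p a (D p x) = x := by
  ext i
  have hN : (N p (B p a x)) i = x (a - 1) := by simp [N, B]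
  have hs : (A p a (D p x)) i = ∑ j, ((if (i - a).val < (j + 1 - a).val then 1 else 0) -
      (if (i - a).val < (j - a).val then 1 else 0)) * x j := by
    simp only [D, T, A, LinearMap.sub_apply, LinearMap.coe_mk, AddHom.coe_mk, LinearMap.id_apply,
      Pi.sub_apply, Finset.sum_sub_distrib, sub_mul, mul_sub]
    congr 1
    exact Fintype.sum_equiv (Equiv.subRight (1 : ZMod p)) _ _ (fun j => by simp)
  have h1 : x (a - 1) = ∑ j, (if j = a - 1 then 1 else 0) * x j := by simp
  rw [Pi.add_apply, hN, hs, h1, ← Finset.sum_add_distrib, Finset.sum_eq_single i]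
  · by_cases h : i = a - 1
    · subst h
      simp
    · have h3 := val_step (i - a) (by intro h3; apply h; linear_combination h3)
      rw [show i - a + 1 = i + 1 - a by ring] at h3
      have : (i - a).val < (i + 1 - a).val := by omega
      simp [h, this]
  · intro j _ hj
    have h4 : (i - a).val ≠ (j - a).val := by
        intro h5; apply hj; have := ZMod.val_injective p h5
        linear_combination -this
    by_cases h : j = a - 1
    · subst h
      rw [show a - 1 - a = -1 by ring, val_m1] at *
      have := ZMod.val_lt (i - a)
      have : (i - a).val < p - 1 := by omega
      simp [this]
    · have h3 := val_step (j - a) (by intro h3; apply h; linear_combination h3)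
      rw [show j - a + 1 = j + 1 - a by ring] at h3
      have : ((i - a).val < (j + 1 - a).val) ↔ ((i - a).val < (j - a).val) := by omega
      simp [h, this]
  · simp

lemma AB (a : ZMod p) (x : M p) : A p a (B p a x) = 0 := by
  ext i
  simp only [B, A, LinearMap.coe_mk, AddHom.coe_mk, Pi.zero_apply]
  apply Finset.sum_eq_zero
  intro j _
  by_cases h : j = a
  · subst h; simp
  · simp [h]

lemma BA (a : ZMod p) (x : M p) : B p a (A p a x) = 0 := by
  ext i
  simp only [B, A, LinearMap.coe_mk, AddHom.coe_mk, Pi.zero_apply, ite_eq_right_iff]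
  intro _
  apply Finset.sum_eq_zero
  intro j _
  rw [show a - 1 - a = -1 by ring, val_m1]
  have := ZMod.val_lt (j - a)
  rw [if_neg (by omega), zero_mul]

lemma TA (g a : ZMod p) (x : M p) : T p g (A p a x) = A p (a + g) (T p g x) := by
  ext i
  simp only [T, A, LinearMap.coe_mk, AddHom.coe_mk]
  refine Fintype.sum_equiv (Equiv.addRight g) _ _ (fun j => ?_)
  have h1 : i - g - a = i - (a + g) := by ring
  have h2 : (Equiv.addRight g) j - (a + g) = j - a := by simp
  have h3 : (Equiv.addRight g) j - g = j := by simp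
  rw [h3]
  simp only [h1, h2]

lemma TB (g a : ZMod p) (x : M p) : T p g (B p a x) = B p (a + g) (T p g x) := by
  ext i
  simp only [T, B, LinearMap.coe_mk, AddHom.coe_mk]
  rw [show a + g - 1 - g = a - 1 by ring]
  simp only [sub_eq_iff_eq_add]

def dd (p : ℕ) [Fact p.Prime] (k : ℕ) : M p →ₗ[ZMod p] M p := if Even k then D p else N p
def ka (k : ℕ) (a : ZMod p) : M p →ₗ[ZMod p] M p := if Even k then B p a else A p a

lemma dk (k : ℕ) (a : ZMod p) (x : M p) :
    dd p (k + 2) (ka (k + 1) a x) + ka k a (dd p (k + 1) x) = x := by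
  by_cases h : Even k
  · simp [dd, ka, h, Nat.even_add_one, idOdd]
  · simp [dd, ka, h, Nat.even_add_one, idEven]

lemma kk (k : ℕ) (a : ZMod p) (x : M p) : ka (k + 1) a (ka k a x) = 0 := by
  by_cases h : Even k
  · simp [ka, h, Nat.even_add_one, AB]
  · simp [ka, h, Nat.even_add_one, BA]

lemma Tk (k : ℕ) (g a : ZMod p) (x : M p) : T p g (ka k a x) = ka k (a + g) (T p g x) := by
  by_cases h : Even k
  · simp [ka, h, TB]
  · simp [ka, h, TA]

lemma D_const (x : M p) (h : D p x = 0) : ∀ i, x i = x 0 := by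
  have h1 : ∀ i, x (i - 1) = x i := fun i => by
    have := congrFun h i
    simpa [D, T, sub_eq_zero] using this
  have h2 : ∀ k : ℕ, x (k : ZMod p) = x 0 := by
    intro k; induction k with
    | zero => simp
    | succ k ih => rw [← ih, ← h1]; simp
  intro i
  rw [← h2 i.val, ZMod.natCast_zmod_val]

lemma D_sum (x y : M p) (h : D p x = D p y) : ∑ i, x i = ∑ i, y i := by
  have := D_const (x - y) (by rw [map_sub, h, sub_self])
  rw [← sub_eq_zero, ← Finset.sum_sub_distrib]
  have h2 : ∀ i, x i - y i = x 0 - y 0 := this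
  simp [h2, ZMod.card]

lemma N_sum (x y : M p) (h : N p x = N p y) : ∑ i, x i = ∑ i, y i := congrFun h 0

end ops

section chains
variable {p : ℕ} [Fact p.Prime]

abbrev Vx (p : ℕ) := ZMod p × ℕ
abbrev Ch (p : ℕ) := List (Vx p) →₀ ZMod p

def shL (g : ZMod p) (l : List (Vx p)) : List (Vx p) := l.map fun v => (v.1 + g, v.2)

noncomputable def cns (a : Vx p) : Ch p →ₗ[ZMod p] Ch p :=
  Finsupp.lmapDomain (ZMod p) (ZMod p) (fun l => a :: l)

noncomputable def sh (g : ZMod p) : Ch p →ₗ[ZMod p] Ch p :=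
  Finsupp.lmapDomain (ZMod p) (ZMod p) (shL g)

noncomputable def bd : List (Vx p) → Ch p
  | [] => 0
  | a :: l => Finsupp.single l 1 - cns a (bd l)

noncomputable def bdl : Ch p →ₗ[ZMod p] Ch p := Finsupp.linearCombination (ZMod p) bd

@[simp] lemma cns_single (a : Vx p) (l) (c : ZMod p) :
    cns a (Finsupp.single l c) = Finsupp.single (a :: l) c := by simp [cns]
@[simp] lemma sh_single (g : ZMod p) (l) (c : ZMod p) :
    sh g (Finsupp.single l c) = Finsupp.single (shL g l) c := by simp [sh]
@[simp] lemma bdl_single (l : List (Vx p)) (c : ZMod p) :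
    bdl (Finsupp.single l c) = c • bd l := by simp [bdl]

lemma bdl_cns (a : Vx p) (x : Ch p) : bdl (cns a x) = x - cns a (bdl x) := by
  induction x using Finsupp.induction_linear with
  | zero => simp
  | add x y hx hy => simp only [map_add, hx, hy]; abel
  | single l c => simp [bd, smul_sub]

lemma bdl_bd (l : List (Vx p)) : bdl (bd l) = 0 := by
  induction l with
  | nil => simp [bd]
  | cons a l ih => simp [bd, bdl_cns, ih]

lemma bdl_bdl (x : Ch p) : bdl (bdl x) = 0 := by
  induction x using Finsupp.induction_linear with
  | zero => simp
  | add x y hx hy => simp [hx, hy]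
  | single l c => simp [bdl_bd]

lemma sh_cns (g : ZMod p) (a : Vx p) (x : Ch p) :
    sh g (cns a x) = cns (a.1 + g, a.2) (sh g x) := by
  induction x using Finsupp.induction_linear with
  | zero => simp
  | add x y hx hy => simp [hx, hy]
  | single l c => simp [shL]

lemma bd_sh (g : ZMod p) (l : List (Vx p)) : bd (shL g l) = sh g (bd l) := by
  induction l with
  | nil => simp [bd, shL]
  | cons a l ih =>
    have : shL g (a :: l) = (a.1 + g, a.2) :: shL g l := rfl
    rw [this]
    simp [bd, ih, sh_cns]

lemma bdl_sh (g : ZMod p) (x : Ch p) : bdl (sh g x) = sh g (bdl x) := by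
  induction x using Finsupp.induction_linear with
  | zero => simp
  | add x y hx hy => simp [hx, hy]
  | single l c => simp [bd_sh]

lemma sh_sh (g h : ZMod p) (x : Ch p) : sh g (sh h x) = sh (g + h) x := by
  induction x using Finsupp.induction_linear with
  | zero => simp
  | add x y hx hy => simp [hx, hy]
  | single l c => simp [shL, Function.comp_def, add_assoc, add_comm h g]

lemma sh_zero (x : Ch p) : sh 0 x = x := by
  induction x using Finsupp.induction_linear with
  | zero => simp
  | add x y hx hy => simp [hx, hy]
  | single l c => simp [shL]

noncomputable def th (p : ℕ) [Fact p.Prime] : ℕ → Ch p →ₗ[ZMod p] Ch p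
  | 0 => LinearMap.id
  | k + 1 => if Even k then sh 1 - LinearMap.id else ∑ g : ZMod p, sh g

noncomputable def hh (p : ℕ) [Fact p.Prime] : ℕ → Ch p
  | 0 => Finsupp.single [] 1
  | k + 1 => cns (0, k) (th p k (hh p k))

lemma bdl_th (k : ℕ) (x : Ch p) : bdl (th p k x) = th p k (bdl x) := by
  cases k with
  | zero => rfl
  | succ k =>
    by_cases h : Even k
    · simp [th, h, bdl_sh]
    · simp [th, h, bdl_sh]

lemma th_th (k : ℕ) (x : Ch p) : th p (k + 2) (th p (k + 1) x) = 0 := by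
  have hsum : ∀ y : Ch p, ∑ g : ZMod p, sh (g + 1) y = ∑ g : ZMod p, sh g y := fun y =>
    Fintype.sum_equiv (Equiv.addRight (1 : ZMod p)) _ _ (fun j => by simp)
  by_cases h : Even k
  · simp [th, h, Nat.even_add_one, sh_sh, hsum]
  · simp only [th, h, Nat.even_add_one, if_false, not_false_eq_true, if_true]
    simp [sh_sh]
    rw [← hsum x]; simp [add_comm]

lemma bd_hh (k : ℕ) : bdl (hh p (k + 1)) = th p k (hh p k) := by
  induction k with
  | zero => simp [hh, th, bd]
  | succ k ih =>
    rw [hh, bdl_cns, bdl_th, ih]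
    cases k with
    | zero => simp [th, hh, shL]
    | succ k => rw [th_th]; simp

variable (s : List (Vx p) → ZMod p)

noncomputable def Ps : ℕ → Ch p →ₗ[ZMod p] M p
  | 0 => Finsupp.linearCombination (ZMod p) (fun _ => (fun _ => 1 : M p))
  | k + 1 => Finsupp.linearCombination (ZMod p) (fun l => ka k (s l) (Ps k (bd l)))

lemma Ps_succ_single (k : ℕ) (l : List (Vx p)) (c : ZMod p) :
    Ps s (k + 1) (Finsupp.single l c) = c • ka k (s l) (Ps s k (bd l)) := by simp [Ps]

lemma dPs_zero (x : Ch p) : dd p 0 (Ps s 0 x) = 0 := by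
  induction x using Finsupp.induction_linear with
  | zero => simp
  | add x y hx hy => simp [hx, hy]
  | single l c =>
    ext i
    simp [Ps, dd, D, T]

lemma dPs (k : ℕ) (x : Ch p) : dd p (k + 1) (Ps s (k + 1) x) = Ps s k (bdl x) := by
  induction k generalizing x with
  | zero =>
    induction x using Finsupp.induction_linear with
    | zero => simp
    | add x y hx hy => simp [hx, hy]
    | single l c =>
      rw [Ps_succ_single, bdl_single, map_smul, map_smul]
      congr 1
      have h := idEven (s l) (Ps s 0 (bd l))
      have h0 := dPs_zero s (bd l)
      simp only [dd, Even.zero, if_true] at h0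
      rw [h0, map_zero, add_zero] at h
      simpa [dd, ka] using h
  | succ k ih =>
    induction x using Finsupp.induction_linear with
    | zero => simp
    | add x y hx hy => simp [hx, hy]
    | single l c =>
      rw [Ps_succ_single, bdl_single, map_smul, map_smul]
      congr 1
      have h := dk k (s l) (Ps s (k + 1) (bd l))
      rw [ih, bdl_bd, map_zero, map_zero, add_zero] at h
      exact h

lemma Ps_sh (hs : ∀ g l, l ≠ [] → s (shL g l) = s l + g) (k : ℕ) (g : ZMod p) (x : Ch p) :
    Ps s k (sh g x) = T p g (Ps s k x) := by
  induction k generalizing x with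
  | zero =>
    induction x using Finsupp.induction_linear with
    | zero => simp
    | add x y hx hy => simp [hx, hy]
    | single l c => ext i; simp [Ps, T]
  | succ k ih =>
    induction x using Finsupp.induction_linear with
    | zero => simp
    | add x y hx hy => simp [hx, hy]
    | single l c =>
      rw [sh_single, Ps_succ_single, Ps_succ_single, map_smul, bd_sh, ih]
      by_cases hl : l = []
      · subst hl; simp [bd]
      · rw [hs g l hl, Tk]

lemma sum_T (x : M p) : ∑ g : ZMod p, T p g x = N p x := by
  ext i
  simp only [Finset.sum_apply, T, N, LinearMap.coe_mk, AddHom.coe_mk]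
  exact Fintype.sum_equiv (Equiv.subLeft i) _ _ (fun j => by simp)

lemma eps (hs : ∀ g l, l ≠ [] → s (shL g l) = s l + g) (k : ℕ) :
    ∑ i, (Ps s (k + 1) (hh p (k + 1))) i = 1 := by
  induction k with
  | zero =>
    have h := dPs s 0 (hh p 1)
    rw [bd_hh] at h
    have := congrFun h 0
    simpa [dd, N, th, hh, Ps] using this
  | succ k ih =>
    rw [← ih]
    have h := dPs s (k + 1) (hh p (k + 2))
    rw [bd_hh] at h
    by_cases hk : Even k
    · apply D_sum
      simpa [dd, hk, Nat.even_add_one, th, Ps_sh s hs, D] using h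
    · apply N_sum
      simpa [dd, hk, Nat.even_add_one, th, Ps_sh s hs, sum_T] using h

/-- coordinates strictly decreasing and below `n` -/
def Good (n : ℕ) (l : List (Vx p)) : Prop := l.Pairwise (fun a b => b.2 < a.2) ∧ ∀ v ∈ l, v.2 < n

lemma Good.sub {n : ℕ} {l l' : List (Vx p)} (h : Good n l) (hl : l'.Sublist l) : Good n l' :=
  ⟨h.1.sublist hl, fun v hv => h.2 v (hl.subset hv)⟩

/-- chains supported on lists satisfying `P` -/
def supp (P : List (Vx p) → Prop) : Submodule (ZMod p) (Ch p) :=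
  Finsupp.supported (ZMod p) (ZMod p) {l | P l}

lemma supp_map {P Q : List (Vx p) → Prop} (f : List (Vx p) → List (Vx p))
    (h : ∀ l, P l → Q (f l)) (x : Ch p) (hx : x ∈ supp P) :
    Finsupp.lmapDomain (ZMod p) (ZMod p) f x ∈ supp Q := by
  classical
  rw [supp, Finsupp.mem_supported] at *
  intro l hl
  have := Finsupp.mapDomain_support hl
  rw [Finset.mem_image] at this
  obtain ⟨l', h1, rfl⟩ := this
  exact h l' (hx h1)

lemma good_sh {n : ℕ} {g : ZMod p} {l : List (Vx p)} (h : Good n l) : Good n (shL g l) := by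
  refine ⟨?_, ?_⟩
  · rw [shL, List.pairwise_map]; exact h.1
  · intro v hv
    rw [shL, List.mem_map] at hv
    obtain ⟨w, hw, rfl⟩ := hv
    exact h.2 w hw

lemma th_supp (n k j : ℕ) (x : Ch p) (hx : x ∈ supp (fun l => Good n l ∧ l.length = j)) :
    th p k x ∈ supp (fun l => Good n l ∧ l.length = j) := by
  have hsh : ∀ g, sh g x ∈ supp (fun l => Good n l ∧ l.length = j) := fun g =>
    supp_map _ (fun l hl => ⟨good_sh hl.1, by simp [shL, hl.2]⟩) x hx
  cases k with
  | zero => exact hx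
  | succ k =>
    by_cases h : Even k
    · simp only [th, h, if_true]
      exact Submodule.sub_mem _ (hsh 1) hx
    · simp only [th, h, if_false, LinearMap.sum_apply]
      exact Submodule.sum_mem _ fun g _ => hsh g

lemma hh_supp (n : ℕ) : hh p n ∈ supp (fun l => Good n l ∧ l.length = n) := by
  induction n with
  | zero => exact Finsupp.single_mem_supported _ _ (by simp [Good])
  | succ n ih =>
    refine supp_map _ ?_ _ (th_supp n n n _ ih)
    rintro l ⟨hl, hn⟩
    refine ⟨⟨List.pairwise_cons.2 ⟨fun v hv => hl.2 v hv, hl.1⟩, ?_⟩, by simp [hn]⟩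
    intro v hv
    rcases List.mem_cons.1 hv with rfl | hv
    · simp
    · exact (hl.2 v hv).trans (Nat.lt_succ_self n)

lemma bd_supp (l : List (Vx p)) :
    bd l ∈ supp (fun l' => l'.Sublist l ∧ l'.length + 1 = l.length) := by
  induction l with
  | nil => exact Submodule.zero_mem _
  | cons a l ih =>
    refine Submodule.sub_mem _ (Finsupp.single_mem_supported _ _ ?_) (supp_map _ ?_ _ ih)
    · simp
    · rintro l' ⟨h1, h2⟩
      exact ⟨h1.cons_cons a, by simp [h2]⟩

lemma exists_supp {P : List (Vx p) → Prop} {x : Ch p} (hx : x ∈ supp P)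
    (f : Ch p →ₗ[ZMod p] M p) (hf : f x ≠ 0) : ∃ l, P l ∧ f (Finsupp.single l 1) ≠ 0 := by
  by_contra! hcon
  apply hf
  rw [supp, Finsupp.mem_supported] at hx
  rw [← Finsupp.sum_single x, Finsupp.sum, map_sum]
  apply Finset.sum_eq_zero
  intro l hl
  have : (Finsupp.single l (x l) : Ch p) = x l • Finsupp.single l 1 := by simp
  rw [this, map_smul, hcon l (hx hl), smul_zero]

/-- The `Z_p`-Tucker type lemma. -/
theorem tucker (n : ℕ) (lev : List (Vx p) → ℕ)
    (hs : ∀ g l, l ≠ [] → s (shL g l) = s l + g)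
    (h1 : ∀ l, Good n l → l ≠ [] → 1 ≤ lev l)
    (h2 : ∀ l l', Good n l → l'.Sublist l → l' ≠ [] → lev l' ≤ lev l)
    (h3 : ∀ l l', Good n l → l'.Sublist l → l' ≠ [] → lev l' = lev l → s l' = s l) :
    ∃ l, Good n l ∧ n ≤ lev l := by
  have key : ∀ k l, Good n l → l.length = k → Ps s k (Finsupp.single l 1) ≠ 0 → k ≤ lev l := by
    intro k
    induction k with
    | zero => intros; omega
    | succ k ih =>
      intro l hl hk hne
      cases k with
      | zero => exact h1 l hl (by rintro rfl; simp at hk)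
      | succ k =>
        rw [Ps_succ_single, one_smul] at hne
        obtain ⟨l', ⟨hsub, hlen⟩, hl'⟩ := exists_supp (bd_supp l)
          ((ka (k + 1) (s l)).comp (Ps s (k + 1))) hne
        rw [LinearMap.comp_apply] at hl'
        have hlen' : l'.length = k + 1 := by omega
        have hne' : l' ≠ [] := by rintro rfl; simp at hlen'
        have i1 := ih l' (hl.sub hsub) hlen' (by intro h0; rw [h0] at hl'; simp at hl')
        have i2 := h2 l l' hl hsub hne'
        have i3 : lev l' ≠ lev l := by
          intro h
          have := h3 l l' hl hsub hne' h
          rw [Ps_succ_single, one_smul, this, kk] at hl'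
          exact hl' rfl
        omega
  cases n with
  | zero => exact ⟨[], by simp [Good], by omega⟩
  | succ n =>
    have hne : Ps s (n + 1) (hh p (n + 1)) ≠ 0 := by
      intro h
      have := eps s hs n
      rw [h] at this
      simp at this
    obtain ⟨l, ⟨a, b⟩, c⟩ := exists_supp (hh_supp (n + 1)) _ hne
    exact ⟨l, a, key _ l a b c⟩

end chains

section signs
variable {p : ℕ} [Fact p.Prime]

lemma exists_sgn {Ω : Type*} (act : ZMod p → Ω → Ω) (h0 : ∀ w, act 0 w = w)
    (hadd : ∀ g h w, act (g + h) w = act g (act h w)) :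
    ∃ sgn : Ω → ZMod p, ∀ w, act 1 w ≠ w → ∀ g, sgn (act g w) = sgn w + g := by
  let st : Setoid Ω :=
    { r := fun a b => ∃ g, act g a = b
      iseqv := ⟨fun a => ⟨0, h0 a⟩, fun {a b} ⟨g, h⟩ => ⟨-g, by rw [← h, ← hadd]; simp [h0]⟩,
        fun {a b c} ⟨g, h⟩ ⟨g', h'⟩ => ⟨g' + g, by rw [hadd, h, h']⟩⟩ }
  have hrep : ∀ w : Ω, ∃ g, act g (Quotient.mk st w).out = w := fun w => Quotient.mk_out (s := st) w
  choose sgn hsgn using hrep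
  refine ⟨sgn, fun w hw g => ?_⟩
  have hq : Quotient.mk st (act g w) = Quotient.mk st w :=
    (Quotient.sound (s := st) ⟨g, rfl⟩).symm
  have e1 := hsgn (act g w)
  have e2 := hsgn w
  rw [hq] at e1
  generalize (Quotient.mk st w).out = r at e1 e2
  by_contra hne
  have e3 : act (sgn (act g w) - (sgn w + g)) r = r := by
    rw [sub_eq_neg_add, hadd, e1, ← hadd]
    rw [show -(sgn w + g) + g = -sgn w by ring]
    have e6 : act (-sgn w) (act (sgn w) r) = r := by rw [← hadd]; simp [h0]
    rwa [e2] at e6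
  have hd : sgn (act g w) - (sgn w + g) ≠ 0 := sub_ne_zero.2 hne
  generalize sgn (act g w) - (sgn w + g) = d at e3 hd
  have e4 : ∀ k : ℕ, act (k * d) r = r := by
    intro k; induction k with
    | zero => simp [h0]
    | succ k ih => push_cast; rw [add_mul, one_mul, hadd, e3, ih]
  have e5 := e4 (d⁻¹).val
  rw [ZMod.natCast_zmod_val, inv_mul_cancel₀ hd] at e5
  apply hw
  rw [← e2, ← hadd, add_comm, hadd, e5]

variable {K : Type*} [DecidableEq K]

def tsh (g : ZMod p) (t : Finset (ZMod p × K)) : Finset (ZMod p × K) :=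
  t.image fun q => (q.1 + g, q.2)

lemma mem_tsh (g : ZMod p) (t : Finset (ZMod p × K)) (q) :
    q ∈ tsh g t ↔ (q.1 - g, q.2) ∈ t := by
  simp only [tsh, Finset.mem_image]
  constructor
  · rintro ⟨a, ha, rfl⟩; simpa using ha
  · intro h; exact ⟨_, h, by simp⟩

def cnt (t : Finset (ZMod p × K)) (e : ZMod p) : ℕ := (t.filter (·.1 = e)).card

def hm (t : Finset (ZMod p × K)) : ℕ := Finset.univ.inf' Finset.univ_nonempty (cnt t)

def As (t : Finset (ZMod p × K)) : Finset (ZMod p) := Finset.univ.filter fun e => cnt t e = hm t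

def bal (t : Finset (ZMod p × K)) : ℕ := ∑ e, min (cnt t e) (hm t + 1)

lemma hm_le (t : Finset (ZMod p × K)) (e) : hm t ≤ cnt t e := Finset.inf'_le _ (Finset.mem_univ e)

lemma hm_ex (t : Finset (ZMod p × K)) : ∃ e, cnt t e = hm t := by
  obtain ⟨e, _, h⟩ := Finset.exists_mem_eq_inf' Finset.univ_nonempty (cnt t)
  exact ⟨e, h.symm⟩

lemma cnt_tsh (g : ZMod p) (t : Finset (ZMod p × K)) (e) : cnt (tsh g t) e = cnt t (e - g) := by
  unfold cnt
  symm
  refine Finset.card_bij (fun q _ => (q.1 + g, q.2)) ?_ ?_ ?_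
  · intro q hq
    simp only [Finset.mem_filter, mem_tsh] at *
    refine ⟨by simpa using hq.1, by rw [hq.2]; ring⟩
  · intro a _ b _ h
    simp only [Prod.mk.injEq, add_left_inj] at h
    exact Prod.ext h.1 h.2
  · intro q hq
    simp only [Finset.mem_filter, mem_tsh] at hq
    exact ⟨(q.1 - g, q.2), by simp only [Finset.mem_filter]; exact ⟨hq.1, by rw [hq.2]⟩, by simp⟩

lemma hm_tsh (g : ZMod p) (t : Finset (ZMod p × K)) : hm (tsh g t) = hm t := by
  apply le_antisymm
  · obtain ⟨e, he⟩ := hm_ex t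
    have := hm_le (tsh g t) (e + g)
    rwa [cnt_tsh, add_sub_cancel_right, he] at this
  · obtain ⟨e, he⟩ := hm_ex (tsh g t)
    rw [← he, cnt_tsh]; exact hm_le _ _

lemma As_tsh (g : ZMod p) (t : Finset (ZMod p × K)) : As (tsh g t) = (As t).image (· + g) := by
  ext e
  simp only [As, Finset.mem_filter, Finset.mem_univ, true_and, Finset.mem_image, cnt_tsh, hm_tsh]
  constructor
  · intro h; exact ⟨_, h, by simp⟩
  · rintro ⟨a, h, rfl⟩; simpa using h

lemma cnt_mono {t t' : Finset (ZMod p × K)} (h : t ⊆ t') (e) : cnt t e ≤ cnt t' e :=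
  Finset.card_le_card (Finset.filter_subset_filter _ h)

lemma hm_mono {t t' : Finset (ZMod p × K)} (h : t ⊆ t') : hm t ≤ hm t' := by
  obtain ⟨e, he⟩ := hm_ex t'
  rw [← he]; exact (hm_le t e).trans (cnt_mono h e)

lemma term_mono {t t' : Finset (ZMod p × K)} (h : t ⊆ t') (e) :
    min (cnt t e) (hm t + 1) ≤ min (cnt t' e) (hm t' + 1) := by
  have := cnt_mono h e
  have := hm_mono h
  omega

lemma bal_mono {t t' : Finset (ZMod p × K)} (h : t ⊆ t') : bal t ≤ bal t' :=
  Finset.sum_le_sum fun e _ => term_mono h e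

lemma bal_eq {t t' : Finset (ZMod p × K)} (h : t ⊆ t') (he : bal t = bal t') :
    As t = As t' ∧ (As t = Finset.univ → t = t') := by
  have h1 : ∀ e, min (cnt t e) (hm t + 1) = min (cnt t' e) (hm t' + 1) := by
    intro e
    exact (Finset.sum_eq_sum_iff_of_le (fun e _ => term_mono h e)).1 he e (Finset.mem_univ e)
  have h2 : hm t = hm t' := by
    obtain ⟨e, he⟩ := hm_ex t
    have := h1 e
    have := hm_mono h
    have := hm_le t' e
    omega
  have h3 : As t = As t' := by
    ext e
    simp only [As, Finset.mem_filter, Finset.mem_univ, true_and]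
    have := h1 e
    have := hm_le t e
    have := hm_le t' e
    omega
  refine ⟨h3, fun hu => ?_⟩
  have h4 : ∀ e, cnt t e = cnt t' e := by
    intro e
    have a : e ∈ As t := by rw [hu]; simp
    have b : e ∈ As t' := by rw [← h3, hu]; simp
    simp only [As, Finset.mem_filter, Finset.mem_univ, true_and] at a b
    omega
  apply Finset.Subset.antisymm h
  intro q hq
  have h5 : t.filter (·.1 = q.1) = t'.filter (·.1 = q.1) :=
    Finset.eq_of_subset_of_card_le (Finset.filter_subset_filter _ h) (h4 q.1).ge
  have : q ∈ t'.filter (·.1 = q.1) := by simp [hq]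
  rw [← h5] at this
  exact (Finset.mem_filter.1 this).1

lemma bal_pos {t : Finset (ZMod p × K)} (h : t ≠ ∅) : 1 ≤ bal t := by
  obtain ⟨q, hq⟩ := Finset.nonempty_iff_ne_empty.2 h
  have h1 : 1 ≤ cnt t q.1 := Finset.card_pos.2 ⟨q, by simp [hq]⟩
  calc 1 ≤ min (cnt t q.1) (hm t + 1) := by omega
    _ ≤ bal t := Finset.single_le_sum (f := fun e => min (cnt t e) (hm t + 1))
      (fun _ _ => Nat.zero_le _) (Finset.mem_univ q.1)

lemma shift_all (P : ZMod p → Prop) (h : ∀ e, P (e - 1) ↔ P e) {e0} (h0 : P e0) : ∀ e, P e := by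
  have h2 : ∀ k : ℕ, P (e0 + k) := by
    intro k; induction k with
    | zero => simpa using h0
    | succ k ih => rw [← h]; push_cast; rwa [← add_assoc, add_sub_cancel_right]
  intro e
  have := h2 (e - e0).val
  rwa [ZMod.natCast_zmod_val, add_sub_cancel] at this

/-- an equivariant sign on free signed sets -/
lemma exists_S (K : Type*) [DecidableEq K] : ∃ S : Finset (ZMod p × K) → ZMod p,
    (∀ t, t ≠ ∅ → (∀ k, ∃ e, (e, k) ∉ t) → ∀ g, S (tsh g t) = S t + g) ∧
    (∀ t t', t ⊆ t' → bal t = bal t' → S t = S t') := by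
  obtain ⟨s1, h1⟩ := exists_sgn (p := p) (Ω := Finset (ZMod p)) (fun g A => A.image (· + g))
    (fun w => by simp) (fun g h w => by
      simp only [Finset.image_image, Function.comp_def]
      congr 1; funext x; ring)
  obtain ⟨s2, h2⟩ := exists_sgn (p := p) (Ω := Finset (ZMod p × K)) tsh
    (fun w => by ext; simp [mem_tsh]) (fun g h w => by
      ext q; simp only [mem_tsh]; rw [sub_sub])
  refine ⟨fun t => if As t = Finset.univ then s2 t else s1 (As t), ?_, ?_⟩
  · intro t ht hk g
    have hiff : As (tsh g t) = Finset.univ ↔ As t = Finset.univ := by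
      rw [As_tsh]
      constructor
      · intro h
        ext e
        have : e + g ∈ (As t).image (· + g) := by rw [h]; simp
        simpa using this
      · intro h; rw [h]; ext e; simp
    by_cases hu : As t = Finset.univ
    · simp only [hiff, hu, if_true]
      apply h2
      intro hfix
      obtain ⟨q, hq⟩ := Finset.nonempty_iff_ne_empty.2 ht
      obtain ⟨e, he⟩ := hk q.2
      refine he (shift_all (fun e => (e, q.2) ∈ t) (fun e => ?_) (e0 := q.1) hq e)
      conv_rhs => rw [← hfix, mem_tsh]
    · simp only [hiff, hu, if_false]
      rw [As_tsh]
      apply h1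
      intro hfix
      obtain ⟨e0, he0⟩ := hm_ex t
      apply hu
      ext e
      simp only [Finset.mem_univ, iff_true]
      refine shift_all (fun e => e ∈ As t) (fun e => ?_) (e0 := e0) (by simp [As, he0]) e
      conv_rhs => rw [← hfix]
      simp [sub_eq_add_neg]
  · intro t t' h he
    obtain ⟨a, b⟩ := bal_eq h he
    by_cases hu : As t = Finset.univ
    · rw [b hu]
    · simp [← a, hu]

end signs

section alt

def altL {G : Type*} [DecidableEq G] (l : List G) : ℕ := (l.destutter (· ≠ ·)).length

lemma altL_mono {G : Type*} [DecidableEq G] {l l' : List G} (h : l'.Sublist l) :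
    altL l' ≤ altL l :=
  List.IsChain.length_le_length_destutter_ne ((List.destutter_sublist _ l').trans h)
    (List.isChain_destutter _ l')

lemma altL_head {G : Type*} [DecidableEq G] {a b : G} {l l' : List G}
    (h : (b :: l').Sublist (a :: l)) (he : altL (b :: l') = altL (a :: l)) : b = a := by
  by_contra hne
  have hs : (b :: l').Sublist l := by
    rcases List.sublist_cons_iff.1 h with h | ⟨r, hr, _⟩
    · exact h
    · simp only [List.cons.injEq] at hr; exact absurd hr.1 hne
  have h1 : (a :: b :: l').destutter (· ≠ ·) = a :: (b :: l').destutter (· ≠ ·) := by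
    rw [List.destutter_cons_cons, if_pos (Ne.symm hne)]; rfl
  have h2 := altL_mono (hs.cons_cons a)
  have h3 : altL (a :: b :: l') = altL (b :: l') + 1 := by
    unfold altL; rw [h1]; rfl
  omega

end alt

section app
variable {p : ℕ} [Fact p.Prime]

lemma altSeq_le {n m : ℕ} {X : Fin n → Option (ZMod p)} (h : HasAltSeq X m) : m ≤ n := by
  obtain ⟨s, hs, _⟩ := h
  simpa using Fintype.card_le_of_injective s hs.injective

lemma le_altVec {n m : ℕ} {X : Fin n → Option (ZMod p)} (h : HasAltSeq X m) : m ≤ altVec X :=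
  le_csSup ⟨n, fun _ h => altSeq_le h⟩ h

lemma altVec_le {n : ℕ} (X : Fin n → Option (ZMod p)) : altVec X ≤ n := by
  refine csSup_le ⟨0, ⟨fun j => j.elim0, fun j => j.elim0, fun j => j.elim0, ?_⟩⟩
    (fun _ h => altSeq_le h)
  intro j h; omega

lemma altL_le_altVec {n : ℕ} {X : Fin n → Option (ZMod p)} {l : List (Vx p)} (hl : Good n l)
    (hX : ∀ v ∈ l, ∀ i : Fin n, i.val = n - 1 - v.2 → X i = some v.1) :
    altL (l.map Prod.fst) ≤ altVec X := by
  obtain ⟨l', hl', he⟩ := List.sublist_map_iff.1 (List.destutter_sublist (· ≠ ·) (l.map Prod.fst))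
  have hch := List.isChain_destutter (· ≠ ·) (l.map Prod.fst)
  have hg := hl.sub hl'
  unfold altL
  rw [he] at hch ⊢
  rw [List.length_map]
  have hlt : ∀ j : Fin l'.length, n - 1 - (l'[j]).2 < n := fun j => by
    have := hg.2 l'[j] (List.getElem_mem _)
    omega
  have hval : ∀ j : Fin l'.length, X ⟨n - 1 - (l'[j]).2, hlt j⟩ = some (l'[j]).1 := fun j =>
    hX _ (hl'.subset (List.getElem_mem _)) _ rfl
  apply le_altVec
  refine ⟨fun j => ⟨n - 1 - (l'[j]).2, hlt j⟩, ?_, ?_, ?_⟩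
  · intro i j hij
    have h1 := List.pairwise_iff_getElem.1 hg.1 i j i.2 j.2 hij
    have h2 := hg.2 l'[i] (List.getElem_mem _)
    simp only [Fin.getElem_fin, Fin.lt_def] at *
    omega
  · intro j; rw [hval]; simp
  · intro j hj
    rw [hval, hval]
    have := List.isChain_iff_getElem.1 hch j (by simpa using hj)
    simpa using this

variable {V : Type*} [Fintype V] {E : Set (Finset V)} {C : ℕ}

open Classical in
noncomputable def tau (c : {e : Finset V // e ∈ E} → Fin C) (co : V → ℕ) (l : List (Vx p)) :
    Finset (ZMod p × Fin C) :=
  Finset.univ.filter fun q => ∃ e : {e : Finset V // e ∈ E}, c e = q.2 ∧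
    ∀ v ∈ e.1, (q.1, co v) ∈ l

lemma mem_tau {c : {e : Finset V // e ∈ E} → Fin C} {co : V → ℕ} {l : List (Vx p)} {q} :
    q ∈ tau c co l ↔ ∃ e : {e : Finset V // e ∈ E}, c e = q.2 ∧ ∀ v ∈ e.1, (q.1, co v) ∈ l := by
  simp [tau]

lemma mem_shL {g : ZMod p} {l : List (Vx p)} {e i} : (e, i) ∈ shL g l ↔ (e - g, i) ∈ l := by
  simp only [shL, List.mem_map]
  constructor
  · rintro ⟨a, ha, h⟩
    simp only [Prod.mk.injEq] at h
    rw [← h.1, ← h.2]; simpa using ha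
  · intro h; exact ⟨_, h, by simp⟩

lemma tau_sh (c : {e : Finset V // e ∈ E} → Fin C) (co : V → ℕ) (g : ZMod p) (l) :
    tau c co (shL g l) = tsh g (tau c co l) := by
  ext q
  simp only [mem_tsh, mem_tau, mem_shL]

lemma good_sh_iff {n : ℕ} {g : ZMod p} {l : List (Vx p)} : Good n (shL g l) ↔ Good n l := by
  refine ⟨fun h => ?_, good_sh⟩
  have := good_sh (g := -g) h
  simpa [shL, Function.comp_def] using this

lemma good_uniq {n : ℕ} {l : List (Vx p)} (h : Good n l) {e e' i} (h1 : (e, i) ∈ l)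
    (h2 : (e', i) ∈ l) : e = e' := by
  by_contra hne
  have hp : l.Pairwise (fun a b : Vx p => a.2 ≠ b.2) := h.1.imp (fun h => h.ne')
  have : Std.Symm (fun a b : Vx p => a.2 ≠ b.2) := ⟨fun a b h => h.symm⟩
  exact hp.forall h1 h2 (by simpa using hne) rfl

lemma tau_disj {co : V → ℕ} {n : ℕ} {l : List (Vx p)}
    (hl : Good n l) {a b : ZMod p} (hab : a ≠ b) {e f : Finset V}
    (he : ∀ v ∈ e, (a, co v) ∈ l) (hf : ∀ v ∈ f, (b, co v) ∈ l) : Disjoint e f := by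
  rw [Finset.disjoint_left]
  intro v h1 h2
  exact hab (good_uniq hl (he v h1) (hf v h2))

end app

end CSK

/-- Any proper coloring of `KG^r(F)` admits a colorful balanced complete `r`-uniform
`p`-partite subhypergraph with at least `|V(F)| − alt_p(F)` vertices. -/
theorem colorful_subhypergraph_kneser {V : Type*} [Fintype V] [DecidableEq V]
    (r p : ℕ) [NeZero p] (hr : 2 ≤ r) (hp : p.Prime) (hrp : r ≤ p)
    (E : Set (Finset V)) (hne : ∀ e ∈ E, e.Nonempty)
    (C : ℕ) (c : {e : Finset V // e ∈ E} → Fin C)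
    (hc : ∀ S ∈ KGEdges E r, ∃ e ∈ S, ∃ f ∈ S, c e ≠ c f) :
    ∃ U : ZMod p → Finset {e : Finset V // e ∈ E},
      (∀ i j, i ≠ j → Disjoint (U i) (U j)) ∧
      SpansComplete (KGEdges E r) r U ∧
      (∀ i j, (U i).card ≤ (U j).card + 1) ∧
      (∀ i, Set.InjOn c ↑(U i)) ∧
      Fintype.card V - altHyp E p ≤ ∑ i, (U i).card := by
  classical
  have : Fact p.Prime := ⟨hp⟩
  set n := Fintype.card V with hn
  obtain ⟨σ, hσ⟩ : ∃ σ : Fin n ≃ V, altHyp E p = altSigma E p σ :=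
    Nat.sInf_mem (s := {a | ∃ σ : Fin (Fintype.card V) ≃ V, a = altSigma E p σ})
      ⟨_, (Fintype.equivFin V).symm, rfl⟩
  obtain ⟨S, hS1, hS2⟩ := CSK.exists_S (p := p) (Fin C)
  set α := altHyp E p with hα
  let co : V → ℕ := fun v => n - 1 - (σ.symm v).val
  -- the coloring is proper, so signed color sets are free
  have hfree : ∀ l : List (CSK.Vx p), CSK.Good n l → ∀ k, ∃ e, (e, k) ∉ CSK.tau c co l := by
    intro l hl k
    by_contra! hall
    have h1 : ∀ e : ZMod p, ∃ f : {e : Finset V // e ∈ E}, c f = k ∧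
        ∀ v ∈ f.1, (e, co v) ∈ l := fun e => CSK.mem_tau.1 (hall e)
    choose f hf1 hf2 using h1
    have hdis : ∀ a b, a ≠ b → Disjoint (f a).1 (f b).1 := fun a b hab =>
      CSK.tau_disj hl hab (hf2 a) (hf2 b)
    have hinj : Function.Injective f := by
      intro a b hab
      by_contra hnab
      have := hdis a b hnab
      rw [hab, Finset.disjoint_self_iff_empty] at this
      exact (hne _ (f b).2).ne_empty this
    obtain ⟨Z, -, hZ⟩ := Finset.exists_subset_card_eq
      (s := (Finset.univ : Finset (ZMod p))) (n := r) (by simpa [ZMod.card] using hrp)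
    obtain ⟨e, he, e', he', hcc⟩ := hc (Z.image f) ⟨by
      rw [Finset.card_image_of_injective _ hinj, hZ], by
      intro e he e' he' hne
      obtain ⟨a, _, rfl⟩ := Finset.mem_image.1 he
      obtain ⟨b, _, rfl⟩ := Finset.mem_image.1 he'
      exact hdis a b (fun h => hne (by rw [h]))⟩
    obtain ⟨a, _, rfl⟩ := Finset.mem_image.1 he
    obtain ⟨b, _, rfl⟩ := Finset.mem_image.1 he'
    exact hcc (by rw [hf1, hf1])
  -- alternation bound
  have halt : ∀ l : List (CSK.Vx p), CSK.Good n l → CSK.tau c co l = ∅ →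
      CSK.altL (l.map Prod.fst) ≤ α := by
    intro l hl ht
    let X : Fin n → Option (ZMod p) := fun i =>
      if h : ∃ e, (e, n - 1 - i.val) ∈ l then some h.choose else none
    have hX1 : ∀ i e, X i = some e → (e, n - 1 - i.val) ∈ l := by
      intro i e h
      by_cases h' : ∃ e, (e, n - 1 - i.val) ∈ l
      · simp only [X, dif_pos h', Option.some.injEq] at h
        rw [← h]; exact h'.choose_spec
      · simp [X, dif_neg h'] at h
    have hX2 : ∀ v ∈ l, ∀ i : Fin n, i.val = n - 1 - v.2 → X i = some v.1 := by
      intro v hv i hi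
      have hlt := hl.2 v hv
      have e1 : n - 1 - i.val = v.2 := by omega
      have h' : ∃ e, (e, n - 1 - i.val) ∈ l := ⟨v.1, by rw [e1]; exact hv⟩
      simp only [X, dif_pos h', Option.some.injEq]
      refine CSK.good_uniq hl h'.choose_spec ?_
      rw [e1]; exact hv
    refine (CSK.altL_le_altVec hl hX2).trans ?_
    rw [hσ]
    refine le_csSup ⟨n, ?_⟩ ⟨X, rfl, ?_⟩
    · rintro a ⟨Y, rfl, -⟩; exact CSK.altVec_le Y
    · intro ε e he hsub
      have : (ε, c ⟨e, he⟩) ∈ CSK.tau c co l := by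
        rw [CSK.mem_tau]
        refine ⟨⟨e, he⟩, rfl, fun v hv => ?_⟩
        obtain ⟨i, hi, rfl⟩ := hsub hv
        simpa [co] using hX1 i ε hi
      rw [ht] at this
      simp at this
  let lev : List (CSK.Vx p) → ℕ := fun l =>
    if CSK.tau c co l = ∅ then CSK.altL (l.map Prod.fst) else α + CSK.bal (CSK.tau c co l)
  let s : List (CSK.Vx p) → ZMod p := fun l =>
    if CSK.Good n l ∧ CSK.tau c co l ≠ ∅ then S (CSK.tau c co l) else (l.head?.getD (0, 0)).1
  have hmono : ∀ l l' : List (CSK.Vx p), l'.Sublist l → CSK.tau c co l' ⊆ CSK.tau c co l := by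
    intro l l' h q hq
    rw [CSK.mem_tau] at *
    obtain ⟨e, h1, h2⟩ := hq
    exact ⟨e, h1, fun v hv => h.subset (h2 v hv)⟩
  have htsh : ∀ g (t : Finset (ZMod p × Fin C)), CSK.tsh g t = ∅ ↔ t = ∅ := by
    intro g t; simp [CSK.tsh]
  obtain ⟨l, hl, hlev⟩ : ∃ l, CSK.Good n l ∧ n ≤ lev l := by
    apply CSK.tucker s n lev
    · intro g l hne
      have e1 : (CSK.Good n (CSK.shL g l) ∧ CSK.tau c co (CSK.shL g l) ≠ ∅) ↔
          (CSK.Good n l ∧ CSK.tau c co l ≠ ∅) := by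
        rw [CSK.good_sh_iff, CSK.tau_sh, Ne, htsh]
      by_cases hgt : CSK.Good n l ∧ CSK.tau c co l ≠ ∅
      · simp only [s, if_pos hgt, if_pos (e1.2 hgt)]
        rw [CSK.tau_sh, hS1 _ hgt.2 (hfree l hgt.1)]
      · simp only [s, if_neg hgt, if_neg (fun h => hgt (e1.1 h))]
        cases l with
        | nil => exact absurd rfl hne
        | cons a l => simp [CSK.shL]
    · intro l hl hne
      by_cases ht : CSK.tau c co l = ∅
      · simp only [lev, if_pos ht]
        rw [CSK.altL, Nat.one_le_iff_ne_zero, Ne, List.length_eq_zero_iff]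
        simpa using hne
      · simp only [lev, if_neg ht]
        have := CSK.bal_pos ht
        omega
    · intro l l' hl hsub hne
      by_cases ht : CSK.tau c co l = ∅
      · have ht' : CSK.tau c co l' = ∅ := Finset.subset_empty.1 (ht ▸ hmono l l' hsub)
        simp only [lev, if_pos ht, if_pos ht']
        exact CSK.altL_mono (hsub.map _)
      · by_cases ht' : CSK.tau c co l' = ∅
        · simp only [lev, if_neg ht, if_pos ht']
          have := halt l' (hl.sub hsub) ht'
          omega
        · simp only [lev, if_neg ht, if_neg ht']
          have := CSK.bal_mono (hmono l l' hsub)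
          omega
    · intro l l' hl hsub hne heq
      by_cases ht : CSK.tau c co l = ∅
      · have ht' : CSK.tau c co l' = ∅ := Finset.subset_empty.1 (ht ▸ hmono l l' hsub)
        simp only [lev, if_pos ht, if_pos ht'] at heq
        simp only [s, ht, ht', ne_eq, not_true_eq_false, and_false, if_false]
        cases l' with
        | nil => exact absurd rfl hne
        | cons b l' =>
          cases l with
          | nil => simp at hsub
          | cons a l =>
            have := hsub.map Prod.fst
            simp only [List.map_cons] at this heq
            simpa using CSK.altL_head this heq
      · by_cases ht' : CSK.tau c co l' = ∅
        · simp only [lev, if_neg ht, if_pos ht'] at heq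
          have := halt l' (hl.sub hsub) ht'
          have := CSK.bal_pos ht
          omega
        · simp only [lev, if_neg ht, if_neg ht'] at heq
          simp only [s, if_pos (And.intro hl ht), if_pos (And.intro (hl.sub hsub) ht')]
          exact hS2 _ _ (hmono l l' hsub) (by omega)
  have hbal : n - α ≤ CSK.bal (CSK.tau c co l) := by
    by_cases ht : CSK.tau c co l = ∅
    · simp only [lev, if_pos ht] at hlev
      have := halt l hl ht
      omega
    · simp only [lev, if_neg ht] at hlev
      omega
  have h1 : ∀ q, q ∈ CSK.tau c co l → ∃ e : {e : Finset V // e ∈ E}, c e = q.2 ∧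
      ∀ v ∈ e.1, (q.1, co v) ∈ l := fun q hq => CSK.mem_tau.1 hq
  choose f hf1 hf2 using h1
  have h2 : ∀ ε : ZMod p, ∃ Z ⊆ (CSK.tau c co l).filter (·.1 = ε),
      Z.card = min (CSK.cnt (CSK.tau c co l) ε) (CSK.hm (CSK.tau c co l) + 1) := fun ε =>
    Finset.exists_subset_card_eq (min_le_left _ _)
  choose Z hZ1 hZ2 using h2
  have hZt : ∀ ε q, q ∈ Z ε → q ∈ CSK.tau c co l := fun ε q h =>
    (Finset.mem_filter.1 (hZ1 ε h)).1
  have hZe : ∀ ε q, q ∈ Z ε → q.1 = ε := fun ε q h => (Finset.mem_filter.1 (hZ1 ε h)).2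
  let U : ZMod p → Finset {e : Finset V // e ∈ E} := fun ε =>
    (Z ε).attach.image fun q => f q.1 (hZt ε q.1 q.2)
  have hU : ∀ ε u, u ∈ U ε → ∃ q, ∃ h : q ∈ Z ε, f q (hZt ε q h) = u := by
    intro ε u hu
    obtain ⟨q, -, h⟩ := Finset.mem_image.1 hu
    exact ⟨q.1, q.2, h⟩
  have hUl : ∀ ε u, u ∈ U ε → ∀ v ∈ u.1, (ε, co v) ∈ l := by
    intro ε u hu
    obtain ⟨q, h, rfl⟩ := hU ε u hu
    have := hf2 q (hZt ε q h)
    rwa [hZe ε q h] at this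
  have hdis : ∀ i j, i ≠ j → ∀ u ∈ U i, ∀ w ∈ U j, Disjoint u.1 w.1 := fun i j hij u hu w hw =>
    CSK.tau_disj hl hij (hUl i u hu) (hUl j w hw)
  have hcard : ∀ ε, (U ε).card =
      min (CSK.cnt (CSK.tau c co l) ε) (CSK.hm (CSK.tau c co l) + 1) := by
    intro ε
    rw [← hZ2, Finset.card_image_of_injective, Finset.card_attach]
    intro q q' h
    have h3 := hf1 q.1 (hZt ε q.1 q.2)
    have h4 := hf1 q'.1 (hZt ε q'.1 q'.2)
    simp only at h
    rw [h, h4] at h3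
    exact Subtype.ext (Prod.ext ((hZe ε q.1 q.2).trans (hZe ε q'.1 q'.2).symm) h3.symm)
  refine ⟨U, ?_, ?_, ?_, ?_, ?_⟩
  · intro i j hij
    rw [Finset.disjoint_left]
    intro u hu hu'
    have := hdis i j hij u hu u hu'
    rw [Finset.disjoint_self_iff_empty] at this
    exact (hne _ u.2).ne_empty this
  · intro T hT hTU hT1
    refine ⟨hT, fun e he f' hf' hne' => ?_⟩
    obtain ⟨i, hi⟩ := hTU e he
    obtain ⟨j, hj⟩ := hTU f' hf'
    by_cases hij : i = j
    · subst hij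
      exact absurd (Finset.card_le_one.1 (hT1 i) e (Finset.mem_inter.2 ⟨he, hi⟩) f'
        (Finset.mem_inter.2 ⟨hf', hj⟩)) hne'
    · exact hdis i j hij e hi f' hj
  · intro i j
    rw [hcard, hcard]
    have := CSK.hm_le (CSK.tau c co l) j
    omega
  · intro ε u hu w hw h
    obtain ⟨q, hq, rfl⟩ := hU ε u hu
    obtain ⟨q', hq', rfl⟩ := hU ε w hw
    rw [hf1, hf1] at h
    have : q = q' := Prod.ext ((hZe ε q hq).trans (hZe ε q' hq').symm) h
    subst this; rfl
  · refine hbal.trans (le_of_eq ?_)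
    rw [CSK.bal]
    exact Finset.sum_congr rfl fun ε _ => (hcard ε).symm
end

section
/- Let r ≥ 2 be an integer, p ≥ r a prime, and F a hypergraph with n vertices. If the Kneser hypergraph KG^r(F) has finite chromatic number, then χ(KG^r(F)) ≥ ⌈(n − alt_p(F)) / (r − 1)⌉. -/
/-- The chromatic number of a hypergraph. -/
noncomputable def chrHyp {W : Type*} (Eh : Set (Finset W)) : ℕ :=
  sInf {C | ∃ c : W → Fin C, ∀ e ∈ Eh, ∃ u ∈ e, ∃ v ∈ e, c u ≠ c v}


namespace KnTucker

set_option linter.unusedSectionVars false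

variable {p : ℕ} {α β : Type*}

/-- coboundary on functions of words -/
def dl : (List α → ZMod p) → List α → ZMod p
  | _, [] => 0
  | f, x :: w => f w - dl (fun u => f (x :: u)) w

/-- prism operator -/
def pr (c : α → α) : (List α → ZMod p) → List α → ZMod p
  | _, [] => 0
  | f, x :: w => f (x :: c x :: w.map c) - pr c (fun u => f (x :: u)) w

lemma dl_nil (f : List α → ZMod p) : dl f [] = 0 := by simp [dl]
lemma dl_cons (f : List α → ZMod p) (x w) :
    dl f (x :: w) = f w - dl (fun u => f (x :: u)) w := by simp [dl]
lemma pr_nil (c : α → α) (f : List α → ZMod p) : pr c f [] = 0 := by simp [pr]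
lemma pr_cons (c : α → α) (f : List α → ZMod p) (x w) :
    pr c f (x :: w) = f (x :: c x :: w.map c) - pr c (fun u => f (x :: u)) w := by simp [pr]

lemma dl_sub (f g : List α → ZMod p) (w) :
    dl (fun u => f u - g u) w = dl f w - dl g w := by
  induction w generalizing f g with
  | nil => simp [dl_nil]
  | cons x w ih => simp only [dl_cons, ih]; ring

lemma pr_sub (c : α → α) (f g : List α → ZMod p) (w) :
    pr c (fun u => f u - g u) w = pr c f w - pr c g w := by
  induction w generalizing f g with
  | nil => simp [pr_nil]
  | cons x w ih => simp only [pr_cons, ih]; ring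

lemma dl_zero (w : List α) : dl (fun _ => (0 : ZMod p)) w = 0 := by
  induction w with
  | nil => simp [dl_nil]
  | cons x w ih => simp only [dl_cons, ih]; ring

lemma dl_add (f g : List α → ZMod p) (w) :
    dl (fun u => f u + g u) w = dl f w + dl g w := by
  induction w generalizing f g with
  | nil => simp [dl_nil]
  | cons x w ih => simp only [dl_cons, ih]; ring

lemma dl_sum {ι : Type*} (S : Finset ι) (f : ι → List α → ZMod p) (w) :
    dl (fun u => ∑ i ∈ S, f i u) w = ∑ i ∈ S, dl (f i) w := by
  classical
  induction S using Finset.induction_on with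
  | empty => simp [dl_zero]
  | insert a S ha ih => simp only [Finset.sum_insert ha, dl_add, ih]

lemma dl_map (m : α → β) (f : List β → ZMod p) (w) :
    dl (fun u => f (u.map m)) w = dl f (w.map m) := by
  induction w generalizing f with
  | nil => simp [dl_nil]
  | cons x w ih =>
    simp only [dl_cons, List.map_cons]
    rw [ih (fun u => f (m x :: u))]

lemma dl_dl (f : List α → ZMod p) (w) : dl (dl f) w = 0 := by
  induction w generalizing f with
  | nil => simp [dl_nil]
  | cons x w ih =>
    simp only [dl_cons, dl_sub, ih]; ring

lemma pr_dl (c : α → α) (f : List α → ZMod p) (w) :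
    pr c (dl f) w + dl (pr c f) w = f (w.map c) - f w := by
  induction w generalizing f with
  | nil => simp [dl_nil, pr_nil]
  | cons x w ih =>
    have h := ih (fun u => f (x :: u))
    simp only [dl_cons, pr_cons, dl_sub, pr_sub, List.map_cons]
    rw [dl_map c (fun u => f (x :: c x :: u))]
    linear_combination h

/-- cone operator -/
def cone (e : α) (c : α → α) (f : List α → ZMod p) (w : List α) : ZMod p :=
  f (e :: w.map c) - pr c f w

lemma cone_dl (e : α) (c : α → α) (f : List α → ZMod p) (w) :
    cone e c (dl f) w = f w - dl (cone e c f) w := by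
  have h := pr_dl c f w
  have h2 : dl (cone e c f) w = dl (fun u => f (e :: u)) (w.map c) - dl (pr c f) w := by
    have : cone e c f = fun u => f (e :: u.map c) - pr c f u := rfl
    rw [this, dl_sub, dl_map c (fun u => f (e :: u))]
  rw [h2]
  simp only [cone, dl_cons]
  linear_combination -h

variable [NeZero p]

/-- the alternating operators -/
def th (act : ZMod p → α → α) (k : ℕ) (f : List α → ZMod p) (w : List α) : ZMod p :=
  if Even k then ∑ t : ZMod p, f (w.map (act t)) else f (w.map (act 1)) - f w

lemma th_sub (act : ZMod p → α → α) (k : ℕ) (f g : List α → ZMod p) (w) :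
    th act k (fun u => f u - g u) w = th act k f w - th act k g w := by
  unfold th; split_ifs
  · simp
  · ring

lemma th_dl (act : ZMod p → α → α) (k : ℕ) (f : List α → ZMod p) (w) :
    dl (th act k f) w = th act k (dl f) w := by
  by_cases h : Even k
  · have : th act k f = fun u => ∑ t : ZMod p, f (u.map (act t)) := by
      funext u; simp [th, h]
    rw [this, dl_sum]; simp [th, h, dl_map]
  · have : th act k f = fun u => f (u.map (act 1)) - f u := by
      funext u; simp [th, h]
    rw [this, dl_sub, dl_map]; simp [th, h]

lemma th_th (act : ZMod p → α → α) (hact : ∀ s t x, act s (act t x) = act (s + t) x)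
    (k : ℕ) (f : List α → ZMod p) (w) :
    th act k (th act (k + 1) f) w = 0 := by
  have hm : ∀ s t (w : List α), (w.map (act t)).map (act s) = w.map (act (s + t)) := by
    intro s t w; simp [List.map_map, Function.comp_def, hact]
  have e1 : ∀ f : List α → ZMod p, ∀ a : ZMod p, ∑ t, f (w.map (act (a + t))) = ∑ t, f (w.map (act t)) := by
    intro f a
    exact Fintype.sum_equiv (Equiv.addLeft a) _ _ (fun x => rfl)
  by_cases h : Even k
  · have h' : ¬ Even (k + 1) := by simpa [Nat.even_add_one] using h
    simp only [th, h, h', if_true, if_false, Finset.sum_sub_distrib, hm, e1, sub_self]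
  · have h' : Even (k + 1) := by simpa [Nat.even_add_one] using h
    have e2 := e1 f 1
    simp only [th, h, h', if_true, if_false, hm]
    simp only [add_comm _ (1 : ZMod p), e2, sub_self]

/-- the functionals -/
def Hh (act : ZMod p → α → α) (e : ℕ → α) (c : ℕ → α → α) :
    ℕ → (List α → ZMod p) → ZMod p
  | 0, f => f [e 0]
  | k + 1, f => Hh act e c k (th act (k + 1) (cone (e (k + 1)) (c (k + 1)) f))

lemma Hh_sub (act : ZMod p → α → α) (e : ℕ → α) (c : ℕ → α → α) (k) (f g : List α → ZMod p) :
    Hh act e c k (fun u => f u - g u) = Hh act e c k f - Hh act e c k g := by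
  induction k generalizing f g with
  | zero => rfl
  | succ k ih =>
    simp only [Hh]
    rw [← ih]
    congr 1
    funext u
    rw [← th_sub]
    congr 1
    funext v
    simp only [cone, pr_sub]; ring

lemma Hh_zero (act : ZMod p → α → α) (e : ℕ → α) (c : ℕ → α → α) (k) :
    Hh act e c k (fun _ => 0) = 0 := by
  have := Hh_sub act e c k (fun _ => 0) (fun _ => 0)
  simpa using this

lemma Hh_dl_of (act : ZMod p → α → α)
    (e : ℕ → α) (c : ℕ → α → α) (k) (f : List α → ZMod p)
    (hz : ∀ g, Hh act e c k (dl (th act (k + 1) g)) = 0) :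
    Hh act e c (k + 1) (dl f) = Hh act e c k (th act (k + 1) f) := by
  have h1 : th act (k + 1) (cone (e (k + 1)) (c (k + 1)) (dl f)) =
      fun u => th act (k + 1) f u - dl (th act (k + 1) (cone (e (k + 1)) (c (k + 1)) f)) u := by
    funext u
    rw [th_dl, ← th_sub]
    congr 1
    funext v
    exact cone_dl _ _ _ _
  have : Hh act e c (k + 1) (dl f) =
      Hh act e c k (th act (k + 1) (cone (e (k + 1)) (c (k + 1)) (dl f))) := rfl
  rw [this, h1, Hh_sub, hz, sub_zero]

lemma Hh_dl_zero (act : ZMod p → α → α) (hact : ∀ s t x, act s (act t x) = act (s + t) x)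
    (e : ℕ → α) (c : ℕ → α → α) (k) (g : List α → ZMod p) :
    Hh act e c k (dl (th act (k + 1) g)) = 0 := by
  induction k generalizing g with
  | zero => simp [Hh, dl_cons, dl_nil, th]
  | succ k ih =>
    rw [Hh_dl_of act e c k _ ih]
    have : th act (k + 1) (th act (k + 1 + 1) g) = fun _ => 0 := by
      funext u; exact th_th act hact _ _ _
    rw [this, Hh_zero]

lemma Hh_dl (act : ZMod p → α → α) (hact : ∀ s t x, act s (act t x) = act (s + t) x)
    (e : ℕ → α) (c : ℕ → α → α) (k) (f : List α → ZMod p) :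
    Hh act e c (k + 1) (dl f) = Hh act e c k (th act (k + 1) f) :=
  Hh_dl_of act e c k f (Hh_dl_zero act hact e c k)

/-- support lemma for the prism -/
lemma pr_zero [Preorder α] (Q Q' : α → Prop) (hQ : ∀ x, Q x → Q' x) (c : α → α)
    (hc : ∀ x, Q x → Q' (c x)) (hle : ∀ x, Q x → x ≤ c x)
    (hmono : ∀ x y, Q x → Q y → x ≤ y → c x ≤ c y) (w : List α) (hw : w.Pairwise (· ≤ ·))
    (hwQ : ∀ x ∈ w, Q x) (f : List α → ZMod p)
    (hf : ∀ u : List α, u.length = w.length + 1 → u.Pairwise (· ≤ ·) → (∀ x ∈ u, Q' x) →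
      (∀ y ∈ u, ∃ x ∈ w, x ≤ y) → f u = 0) : pr c f w = 0 := by
  induction w generalizing f with
  | nil => exact pr_nil _ _
  | cons x w ih =>
    rw [List.pairwise_cons] at hw
    have hx : Q x := hwQ x (by simp)
    have hw' : ∀ y ∈ w, Q y := fun y hy => hwQ y (by simp [hy])
    rw [pr_cons, hf, ih hw.2 hw', sub_zero]
    · intro u h1 h2 h3 h4
      apply hf
      · simp [h1]
      · rw [List.pairwise_cons]
        refine ⟨fun y hy => ?_, h2⟩
        obtain ⟨z, hz, hzy⟩ := h4 y hy
        exact (hw.1 z hz).trans hzy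
      · intro y hy
        rcases List.mem_cons.1 hy with rfl | hy
        · exact hQ _ hx
        · exact h3 y hy
      · intro y hy
        rcases List.mem_cons.1 hy with rfl | hy
        · exact ⟨y, by simp, le_rfl⟩
        · obtain ⟨z, hz, hzy⟩ := h4 y hy
          exact ⟨z, by simp [hz], hzy⟩
    · simp
    · rw [List.pairwise_cons, List.pairwise_cons, List.pairwise_map]
      refine ⟨?_, ?_, ?_⟩
      · intro y hy
        rcases List.mem_cons.1 hy with rfl | hy
        · exact hle _ hx
        · obtain ⟨z, hz, rfl⟩ := List.mem_map.1 hy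
          exact (hw.1 z hz).trans (hle _ (hw' z hz))
      · intro y hy
        obtain ⟨z, hz, rfl⟩ := List.mem_map.1 hy
        exact hmono _ _ hx (hw' z hz) (hw.1 z hz)
      · exact hw.2.imp_of_mem (fun {a b} ha hb hab => hmono _ _ (hw' a ha) (hw' b hb) hab)
    · intro y hy
      rcases List.mem_cons.1 hy with rfl | hy
      · exact hQ _ hx
      rcases List.mem_cons.1 hy with rfl | hy
      · exact hc _ hx
      · obtain ⟨z, hz, rfl⟩ := List.mem_map.1 hy
        exact hc _ (hw' z hz)
    · intro y hy
      rcases List.mem_cons.1 hy with rfl | hy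
      · exact ⟨y, by simp, le_rfl⟩
      rcases List.mem_cons.1 hy with rfl | hy
      · exact ⟨x, by simp, hle _ hx⟩
      · obtain ⟨z, hz, rfl⟩ := List.mem_map.1 hy
        exact ⟨z, by simp [hz], hle _ (hw' z hz)⟩

/-- support lemma for the functionals -/
lemma Hh_supp [Preorder α] (act : ZMod p → α → α) (e : ℕ → α) (c : ℕ → α → α)
    (hactm : ∀ t x y, x ≤ y → act t x ≤ act t y)
    (Q : ℕ → α → Prop) (hQ : ∀ k x, Q k x → Q (k + 1) x)
    (hQact : ∀ k t x, Q k x → Q k (act t x)) (d : ℕ)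
    (hc : ∀ k ≤ d, ∀ x, Q k x → Q (k + 1) (c k x)) (hle : ∀ k ≤ d, ∀ x, Q k x → x ≤ c k x)
    (hmono : ∀ k ≤ d, ∀ x y, Q k x → Q k y → x ≤ y → c k x ≤ c k y)
    (he : ∀ k ≤ d, Q (k + 1) (e k)) (hec : ∀ k ≤ d, ∀ x, Q k x → e k ≤ c k x)
    (k : ℕ) (hk : k ≤ d) (f : List α → ZMod p)
    (hf : ∀ u : List α, u.length = k + 1 → u.Pairwise (· ≤ ·) → (∀ x ∈ u, Q (k + 1) x) →
      f u = 0) : Hh act e c k f = 0 := by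
  induction k generalizing f with
  | zero =>
    apply hf
    · simp
    · simp
    · simpa using he 0 hk
  | succ k ih =>
    apply ih (by omega)
    have hcone : ∀ u : List α, u.length = k + 1 → u.Pairwise (· ≤ ·) → (∀ x ∈ u, Q (k + 1) x) →
        cone (e (k + 1)) (c (k + 1)) f u = 0 := by
      intro u h1 h2 h3
      unfold cone
      rw [pr_zero (Q (k + 1)) (Q (k + 1 + 1)) (hQ _) (c (k + 1)) (hc _ hk) (hle _ hk)
        (hmono _ hk) u h2 h3, hf, sub_zero]
      · simp [h1]
      · rw [List.pairwise_cons, List.pairwise_map]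
        refine ⟨?_, h2.imp_of_mem
          (fun {a b} ha hb hab => hmono _ hk _ _ (h3 a ha) (h3 b hb) hab)⟩
        intro y hy
        obtain ⟨z, hz, rfl⟩ := List.mem_map.1 hy
        exact hec _ hk _ (h3 z hz)
      · intro y hy
        rcases List.mem_cons.1 hy with rfl | hy
        · exact he _ hk
        · obtain ⟨z, hz, rfl⟩ := List.mem_map.1 hy
          exact hc _ hk _ (h3 z hz)
      · intro v g1 g2 g3 _
        exact hf v (by omega) g2 g3
    intro u h1 h2 h3
    have hsh : ∀ t, cone (e (k + 1)) (c (k + 1)) f (u.map (act t)) = 0 := by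
      intro t
      apply hcone
      · simp [h1]
      · rw [List.pairwise_map]; exact h2.imp (fun {a b} h => hactm t _ _ h)
      · intro y hy
        obtain ⟨z, hz, rfl⟩ := List.mem_map.1 hy
        exact hQact _ _ _ (h3 z hz)
    unfold th
    simp only [hsh, hcone u h1 h2 h3]
    simp

/-- normalized cochains -/
def Nm (f : List α → ZMod p) : Prop := ∀ w, ¬ List.IsChain (· ≠ ·) w → f w = 0

lemma Nm_dl (f : List α → ZMod p) (hf : Nm f) : Nm (dl f) := by
  have : ∀ (w : List α) (f : List α → ZMod p), Nm f → ¬ List.IsChain (· ≠ ·) w → dl f w = 0 := by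
    intro w
    induction w with
    | nil => intro f hf h; exact dl_nil _
    | cons x w ih =>
      intro f hf h
      have hx : Nm (fun u => f (x :: u)) := by
        intro u hu
        apply hf
        intro hc
        exact hu hc.tail
      by_cases hw : List.IsChain (· ≠ ·) w
      · cases w with
        | nil => simp at h
        | cons y w =>
          have hxy : x = y := by
            by_contra hne
            exact h (List.isChain_cons_cons.2 ⟨hne, hw⟩)
          subst hxy
          simp only [dl_cons]
          have : dl (fun u => f (x :: x :: u)) w = 0 := by
            have : (fun u => f (x :: x :: u)) = fun _ => 0 := by
              funext u
              apply hf
              intro hc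
              exact (List.isChain_cons_cons.1 hc).1 rfl
            rw [this, dl_zero]
          rw [this]; ring
      · rw [dl_cons, ih _ hx hw, hf w hw, sub_zero]
  intro w hw
  exact this w f hf hw

/-- the cochains -/
def ph (p : ℕ) : ℕ → List (ZMod p) → ZMod p
  | 0, w => if w = [] then 1 else 0
  | _ + 1, [] => 0
  | k + 1, a :: w =>
    if Even (k + 1) then (if a = 0 then dl (ph p k) (a :: w) else 0)
    else ∑ j ∈ Finset.range a.val, dl (ph p k) ((a :: w).map (fun x => ((j : ZMod p) - a) + x))

lemma Nm_ph (k : ℕ) : Nm (ph p k) := by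
  induction k with
  | zero =>
    intro w hw
    have : w ≠ [] := by rintro rfl; simp at hw
    simp [ph, this]
  | succ k ih =>
    intro w hw
    cases w with
    | nil => simp at hw
    | cons a w =>
      have h := Nm_dl _ ih
      rw [ph]
      split_ifs
      · exact h _ hw
      · rfl
      · apply Finset.sum_eq_zero
        intro j _
        apply h
        intro hc
        apply hw
        rw [List.isChain_map] at hc
        exact hc.imp (fun x y hxy hh => hxy (by rw [hh]))

lemma ph_step (k : ℕ) (h : ∀ w, th (fun t x => t + x) k (dl (ph p k)) w = 0) (w) :
    th (fun t x => t + x) (k + 1) (ph p (k + 1)) w = dl (ph p k) w := by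
  have hmm : ∀ (s t : ZMod p) (w : List (ZMod p)),
      (w.map (fun x => t + x)).map (fun x => s + x) = w.map (fun x => (s + t) + x) := by
    intro s t w; simp [List.map_map, Function.comp_def, add_assoc]
  cases w with
  | nil => simp [th, ph, dl_nil]
  | cons a w =>
  by_cases hk : Even k
  · have hk' : ¬ Even (k + 1) := by simpa [Nat.even_add_one] using hk
    simp only [th, hk, if_true] at h
    simp only [th, hk', if_false]
    rw [List.map_cons, ph, ph, if_neg hk', if_neg hk', ← List.map_cons (f := fun x => 1 + x)]
    simp only [hmm]
    have e0 : ∀ j : ℕ, (j : ZMod p) - (1 + a) + 1 = j - a := by intro j; ring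
    simp only [e0]
    have hav := ZMod.val_lt a
    have hval : (((a.val : ℕ) : ZMod p) - a) = 0 := by simp
    by_cases hlt : a.val + 1 < p
    · have : (1 + a).val = a.val + 1 := by
        rw [add_comm, ZMod.val_add_of_lt]
        · have : Fact (1 < p) := ⟨by omega⟩
          rw [ZMod.val_one]
        · have : Fact (1 < p) := ⟨by omega⟩
          rw [ZMod.val_one]; exact hlt
      rw [this, Finset.sum_range_succ, hval]
      simp
    · have hp1 : a.val + 1 = p := by omega
      have : (1 + a) = 0 := by
        have : ((a.val + 1 : ℕ) : ZMod p) = 0 := by rw [hp1]; simp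
        rw [add_comm]; simpa using this
      rw [this]
      have h2 := h ((a :: w).map (fun x => -a + x))
      have h3 : ∑ j ∈ Finset.range p, dl (ph p k) ((a :: w).map (fun x => ((j : ZMod p) - a) + x)) = 0 := by
        rw [← h2]
        simp only [hmm]
        refine Finset.sum_bij' (fun i _ => (i : ZMod p)) (fun j _ => j.val) ?_ ?_ ?_ ?_ ?_
        · intro i _; simp
        · intro j _; simpa using ZMod.val_lt j
        · intro i hi; exact ZMod.val_natCast_of_lt (Finset.mem_range.1 hi)
        · intro j _; simp
        · intro i _; simp only [sub_eq_add_neg]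
      have h4 : ∑ j ∈ Finset.range (a.val + 1), dl (ph p k) ((a :: w).map (fun x => ((j : ZMod p) - a) + x)) = 0 := by
        rw [hp1]; exact h3
      rw [Finset.sum_range_succ, hval] at h4
      simp at h4 ⊢
      linear_combination -h4
  · have hk' : Even (k + 1) := by simpa [Nat.even_add_one] using hk
    simp only [th, hk, if_false] at h
    have hinv : ∀ (j : ℕ) w, dl (ph p k) (w.map (fun x => (j : ZMod p) + x)) = dl (ph p k) w := by
      intro j w
      induction j with
      | zero => simp
      | succ j ih =>
        rw [← ih, ← sub_eq_zero, ← h (w.map (fun x => (j : ZMod p) + x)), hmm]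
        push_cast
        simp only [add_comm (1 : ZMod p)]
    have hinv' : ∀ (t : ZMod p) w, dl (ph p k) (w.map (fun x => t + x)) = dl (ph p k) w := by
      intro t w
      have := hinv t.val w
      simpa using this
    simp only [th, hk', if_true]
    have : ∀ t : ZMod p, ph p (k + 1) ((a :: w).map (fun x => t + x)) =
        if t = -a then dl (ph p k) (a :: w) else 0 := by
      intro t
      rw [List.map_cons, ph, if_pos hk', ← List.map_cons (f := fun x => t + x), hinv']
      simp only [add_eq_zero_iff_eq_neg]
    simp only [this]
    simp

lemma ph_spec (k : ℕ) (w) :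
    th (fun t x => t + x) (k + 1) (ph p (k + 1)) w = dl (ph p k) w := by
  apply ph_step
  induction k with
  | zero =>
    intro w
    have : ∀ t : ZMod p, dl (ph p 0) (w.map (fun x => t + x)) = dl (ph p 0) w := by
      intro t
      rw [← dl_map]
      congr 1
      funext u
      simp [ph]
    simp [th, this]
  | succ k ih =>
    intro w
    rw [← th_dl]
    have : th (fun t x => t + x) (k + 1) (ph p (k + 1)) = dl (ph p k) := by
      funext u; exact ph_step k ih u
    rw [this, dl_dl]

theorem tucker_abs [Fact p.Prime] [Preorder α] (act : ZMod p → α → α) (e : ℕ → α) (c : ℕ → α → α)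
    (hact : ∀ s t x, act s (act t x) = act (s + t) x)
    (hactm : ∀ t x y, x ≤ y → act t x ≤ act t y)
    (Q : ℕ → α → Prop) (hQ : ∀ k x, Q k x → Q (k + 1) x)
    (hQact : ∀ k t x, Q k x → Q k (act t x)) (d : ℕ)
    (hc : ∀ k ≤ d, ∀ x, Q k x → Q (k + 1) (c k x)) (hle : ∀ k ≤ d, ∀ x, Q k x → x ≤ c k x)
    (hmono : ∀ k ≤ d, ∀ x y, Q k x → Q k y → x ≤ y → c k x ≤ c k y)
    (he : ∀ k ≤ d, Q (k + 1) (e k)) (hec : ∀ k ≤ d, ∀ x, Q k x → e k ≤ c k x)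
    (s : α → ZMod p) (hs : ∀ t x, s (act t x) = t + s x)
    (l : α → ℕ) (hl : ∀ x y, x ≤ y → l x ≤ l y) (hl1 : ∀ x, 1 ≤ l x) (hld : ∀ x, l x ≤ d)
    (hls : ∀ x y, x ≤ y → l x = l y → s x = s y) : False := by
  set f : ℕ → List α → ZMod p := fun k w => ph p k (w.map s) with hfdef
  have hf : ∀ k, th act (k + 1) (f (k + 1)) = dl (f k) := by
    intro k
    funext w
    have h1 : dl (f k) w = dl (ph p k) (w.map s) := dl_map s _ w
    rw [h1, ← ph_spec]
    simp [th, hfdef, List.map_map, Function.comp_def, hs]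
  have hstep : ∀ k, Hh act e c k (th act (k + 1) (f (k + 1))) = 1 := by
    intro k
    induction k with
    | zero => rw [hf]; simp [Hh, dl_cons, dl_nil, hfdef, ph]
    | succ k ih => rw [hf, Hh_dl act hact, ih]
  have h0 : Hh act e c d (th act (d + 1) (f (d + 1))) = 0 := by
    apply Hh_supp act e c hactm Q hQ hQact d hc hle hmono he hec d le_rfl
    have hv : ∀ u : List α, u.length = d + 1 → u.Pairwise (· ≤ ·) → f (d + 1) u = 0 := by
      intro u h1 h2
      apply Nm_ph
      intro hch
      rw [List.isChain_map] at hch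
      have h3 : List.IsChain (fun a b => l a < l b) u := by
        have h2' := h2.isChain
        have h5 : List.IsChain (fun a b => s a ≠ s b ∧ a ≤ b) u := by
          rw [List.isChain_iff_getElem] at hch h2' ⊢
          exact fun i hi => ⟨hch i hi, h2' i hi⟩
        refine h5.imp ?_
        rintro a b ⟨hab, hab'⟩
        exact lt_of_le_of_ne (hl _ _ hab') (fun h => hab (hls _ _ hab' h))
      have h4 : (u.map l).Pairwise (· < ·) := by
        rw [← List.isChain_iff_pairwise, List.isChain_map]; exact h3
      have h5 : (u.map l).Nodup := h4.imp (fun h => ne_of_lt h)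
      have h6 : (u.map l).toFinset ⊆ Finset.Icc 1 d := by
        intro x hx
        simp only [List.mem_toFinset, List.mem_map] at hx
        obtain ⟨a, _, rfl⟩ := hx
        exact Finset.mem_Icc.2 ⟨hl1 a, hld a⟩
      have h7 := Finset.card_le_card h6
      rw [List.toFinset_card_of_nodup h5] at h7
      simp at h7
      omega
    intro u h1 h2 h3
    unfold th
    have hsh : ∀ t, f (d + 1) (u.map (act t)) = 0 := by
      intro t
      apply hv
      · simp [h1]
      · rw [List.pairwise_map]; exact h2.imp (fun {a b} h => hactm t _ _ h)
    simp only [hsh, hv u h1 h2]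
    simp
  have := hstep d
  rw [h0] at this
  exact zero_ne_one this

/-- nonzero sign vectors -/
def PV (n p : ℕ) : Type := {X : Fin n → Option (ZMod p) // ∃ i, X i ≠ none}

/-- order on raw vectors -/
def leV {n p : ℕ} (X Y : Fin n → Option (ZMod p)) : Prop := ∀ i, X i ≠ none → Y i = X i

instance (n p : ℕ) : Preorder (PV n p) where
  le X Y := leV X.1 Y.1
  le_refl X := fun i _ => rfl
  le_trans X Y Z h1 h2 := fun i hi => by
    have h := h1 i hi
    rw [← h] at hi ⊢
    exact h2 i hi

lemma PV_le {n p : ℕ} {X Y : PV n p} : X ≤ Y ↔ leV X.1 Y.1 := Iff.rfl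

/-- shift of raw vectors -/
def shV {n p : ℕ} (t : ZMod p) (X : Fin n → Option (ZMod p)) : Fin n → Option (ZMod p) :=
  fun i => (X i).map (fun x => t + x)

lemma shV_ne {n p : ℕ} (t : ZMod p) (X : Fin n → Option (ZMod p)) (i) :
    shV t X i ≠ none ↔ X i ≠ none := by simp [shV]

lemma shV_some {n p : ℕ} (t : ZMod p) (X : Fin n → Option (ZMod p)) (i) (a : ZMod p) :
    shV t X i = some (t + a) ↔ X i = some a := by simp [shV]

/-- action -/
def actV {n p : ℕ} (t : ZMod p) (X : PV n p) : PV n p :=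
  ⟨shV t X.1, by obtain ⟨i, hi⟩ := X.2; exact ⟨i, (shV_ne _ _ _).2 hi⟩⟩

theorem tucker_conc {n p : ℕ} [Fact p.Prime] (d : ℕ) (hd : d < n)
    (s : PV n p → ZMod p) (hs : ∀ t x, s (actV t x) = t + s x)
    (l : PV n p → ℕ) (hl : ∀ x y, x ≤ y → l x ≤ l y) (hl1 : ∀ x, 1 ≤ l x) (hld : ∀ x, l x ≤ d)
    (hls : ∀ x y, x ≤ y → l x = l y → s x = s y) : False := by
  have hex : ∀ k : ℕ, ∃ e : PV n p, k ≤ d → e.1 = fun i => if i.val = k then some 0 else none := by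
    intro k
    by_cases hk : k ≤ d
    · exact ⟨⟨fun i => if i.val = k then some 0 else none, ⟨k, by omega⟩, by simp⟩, fun _ => rfl⟩
    · exact ⟨⟨fun _ => some 0, ⟨0, by omega⟩, by simp⟩, fun h => absurd h hk⟩
  choose e he using hex
  let c : ℕ → PV n p → PV n p := fun k X => ⟨fun i => if i.val = k then some 0 else X.1 i, by
    obtain ⟨i, hi⟩ := X.2
    refine ⟨i, ?_⟩
    by_cases h : i.val = k
    · simp [h]
    · simpa [h] using hi⟩
  have hcv : ∀ k X i, (c k X).1 i = if i.val = k then some 0 else X.1 i := fun _ _ _ => rfl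
  refine tucker_abs (actV (n := n) (p := p)) e c ?_ ?_ (fun k X => ∀ i : Fin n, k ≤ i.val → X.1 i = none)
    ?_ ?_ d ?_ ?_ ?_ ?_ ?_ s hs l hl hl1 hld hls
  · intro a b x
    apply Subtype.ext
    funext i
    simp [actV, shV, Function.comp_def, add_assoc]
  · intro t x y h i hi
    have := h i ((shV_ne _ _ _).1 hi)
    simp [actV, shV, this]
  · intro k x h i hi
    exact h i (by omega)
  · intro k t x h i hi
    simp [actV, shV, h i hi]
  · intro k hk x h i hi
    rw [hcv, if_neg (by omega), h i (by omega)]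
  · intro k hk x h i hi
    rw [hcv, if_neg]
    intro hik
    exact hi (h i (by omega))
  · intro k hk x y hx hy h i hi
    rw [hcv] at hi ⊢
    rw [hcv]
    split_ifs at hi ⊢
    · rfl
    · exact h i hi
  · intro k hk i hi
    rw [he k hk]
    simp; omega
  · intro k hk x hx i hi
    rw [he k hk] at hi ⊢
    rw [hcv]
    by_cases hik : i.val = k <;> simp_all

/-! alternating sequences -/

lemma hasAlt_le {n p : ℕ} {X : Fin n → Option (ZMod p)} {m : ℕ} (h : HasAltSeq X m) : m ≤ n := by
  obtain ⟨s, hs, _⟩ := h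
  simpa using Fintype.card_le_of_injective s hs.injective

lemma hasAlt_bdd {n p : ℕ} (X : Fin n → Option (ZMod p)) : BddAbove {m | HasAltSeq X m} :=
  ⟨n, fun _ h => hasAlt_le h⟩

lemma le_altVec {n p : ℕ} {X : Fin n → Option (ZMod p)} {m : ℕ} (h : HasAltSeq X m) :
    m ≤ altVec X := le_csSup (hasAlt_bdd X) h

lemma hasAlt_zero {n p : ℕ} (X : Fin n → Option (ZMod p)) : HasAltSeq X 0 :=
  ⟨fun i => i.elim0, fun i => i.elim0, fun i => i.elim0, fun j h => by omega⟩

lemma hasAlt_altVec {n p : ℕ} (X : Fin n → Option (ZMod p)) : HasAltSeq X (altVec X) :=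
  Nat.sSup_mem ⟨0, hasAlt_zero X⟩ (hasAlt_bdd X)

lemma altVec_le {n p : ℕ} (X : Fin n → Option (ZMod p)) : altVec X ≤ n :=
  hasAlt_le (hasAlt_altVec X)

lemma altVec_pos {n p : ℕ} {X : Fin n → Option (ZMod p)} (h : ∃ i, X i ≠ none) :
    1 ≤ altVec X := by
  obtain ⟨i, hi⟩ := h
  exact le_altVec ⟨fun _ => i, Subsingleton.strictMono _, fun _ => hi, fun j h => by omega⟩

lemma hasAlt_mono {n p : ℕ} {X Y : Fin n → Option (ZMod p)} (h : leV X Y) {m : ℕ}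
    (hX : HasAltSeq X m) : HasAltSeq Y m := by
  obtain ⟨s, h1, h2, h3⟩ := hX
  refine ⟨s, h1, fun j => ?_, fun j hj => ?_⟩
  · rw [h _ (h2 j)]; exact h2 j
  · rw [h _ (h2 _), h _ (h2 _)]; exact h3 j hj

lemma altVec_mono {n p : ℕ} {X Y : Fin n → Option (ZMod p)} (h : leV X Y) :
    altVec X ≤ altVec Y := le_altVec (hasAlt_mono h (hasAlt_altVec X))

lemma hasAlt_shV {n p : ℕ} (t : ZMod p) {X : Fin n → Option (ZMod p)} {m : ℕ}
    (hX : HasAltSeq X m) : HasAltSeq (shV t X) m := by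
  obtain ⟨s, h1, h2, h3⟩ := hX
  refine ⟨s, h1, fun j => (shV_ne _ _ _).2 (h2 j), fun j hj => ?_⟩
  intro h
  apply h3 j hj
  exact Option.map_injective (add_right_injective t) h

lemma shV_shV {n p : ℕ} (t : ZMod p) (X : Fin n → Option (ZMod p)) : shV (-t) (shV t X) = X := by
  funext i
  simp [shV, Function.comp_def]

lemma altVec_shV {n p : ℕ} (t : ZMod p) (X : Fin n → Option (ZMod p)) :
    altVec (shV t X) = altVec X := by
  apply le_antisymm
  · have := hasAlt_shV (-t) (hasAlt_altVec (shV t X))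
    rw [shV_shV] at this
    exact le_altVec this
  · exact le_altVec (hasAlt_shV t (hasAlt_altVec X))

/-- prepending to an alternating sequence -/
lemma hasAlt_cons {n p : ℕ} {X : Fin n → Option (ZMod p)} {m : ℕ} (s : Fin (m + 1) → Fin n)
    (h1 : StrictMono s) (h2 : ∀ j, X (s j) ≠ none)
    (h3 : ∀ (j : ℕ) (h : j + 1 < m + 1), X (s ⟨j, by omega⟩) ≠ X (s ⟨j + 1, h⟩))
    (i : Fin n) (hi : i < s 0) (hin : X i ≠ none) (hne : X i ≠ X (s 0)) :
    HasAltSeq X (m + 2) := by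
  refine ⟨Fin.cons i s, ?_, ?_, ?_⟩
  · rw [Fin.strictMono_iff_lt_succ]
    intro j
    refine Fin.cases ?_ (fun j => ?_) j
    · simpa using hi
    · rw [Fin.cons_succ, ← Fin.succ_castSucc, Fin.cons_succ]
      exact h1 (Fin.castSucc_lt_succ)
  · intro j
    refine Fin.cases ?_ (fun j => ?_) j
    · simpa using hin
    · simpa using h2 j
  · intro j hj
    cases j with
    | zero => exact hne
    | succ j => exact h3 j (by omega)

lemma first_sign {n p : ℕ} {X Y : Fin n → Option (ZMod p)} (h : leV X Y) (hX : ∃ i, X i ≠ none)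
    (halt : altVec X = altVec Y) (i j : Fin n) (a b : ZMod p)
    (hi : X i = some a) (hi' : ∀ k < i, X k = none)
    (hj : Y j = some b) (hj' : ∀ k < j, Y k = none) : a = b := by
  have hpos := altVec_pos hX
  have hA := hasAlt_altVec X
  obtain ⟨m, hm⟩ : ∃ m, altVec X = m + 1 := ⟨altVec X - 1, by omega⟩
  rw [hm] at hA
  obtain ⟨s, h1, h2, h3⟩ := hA
  have key : ∀ (Z : Fin n → Option (ZMod p)), leV X Z → altVec X = altVec Z →
      ∀ (j : Fin n) (b), Z j = some b → (∀ k < j, Z k = none) → some b = X (s 0) := by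
    intro Z hZ hZa j b hj hj'
    have hz : ∀ j, Z (s j) = X (s j) := fun j => hZ _ (h2 j)
    by_contra hne
    have hlt : j < s 0 := by
      rcases lt_trichotomy j (s 0) with h | h | h
      · exact h
      · rw [h, hz] at hj; exact absurd hj.symm hne
      · exact absurd ((hz 0).symm.trans (hj' _ h)) (h2 0)
    have := le_altVec (hasAlt_cons (X := Z) s h1 (fun j => by rw [hz]; exact h2 j)
      (fun j hj => by rw [hz, hz]; exact h3 j hj) j hlt (by simp [hj]) (by rw [hj, hz]; exact hne))
    omega
  have e1 := key X (fun _ _ => rfl) rfl i a hi hi'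
  have e2 := key Y h halt j b hj hj'
  exact Option.some_injective _ (e1.trans e2.symm)

/-- shift of a finite set of signed colours -/
def shA {p C : ℕ} (t : ZMod p) : ZMod p × Fin C ↪ ZMod p × Fin C :=
  ⟨fun q => (t + q.1, q.2), fun a b h => by
    simp only [Prod.mk.injEq, add_right_inj] at h
    exact Prod.ext h.1 h.2⟩

lemma shA_apply {p C : ℕ} (t : ZMod p) (q : ZMod p × Fin C) : shA t q = (t + q.1, q.2) := rfl

/-- equivariant sign of a finite set of signed colours -/
noncomputable def mn {p C : ℕ} (A : Finset (ZMod p × Fin C)) : ZMod p :=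
  if h : (A.image Prod.snd).Nonempty then
    (∑ q ∈ A with q.2 = (A.image Prod.snd).min' h, q.1) *
      ((A.filter (fun q => q.2 = (A.image Prod.snd).min' h)).card : ZMod p)⁻¹
  else 0

lemma mn_shift {p C : ℕ} [Fact p.Prime] (t : ZMod p) (A : Finset (ZMod p × Fin C))
    (hA : A.Nonempty) (hc : ∀ c, (A.filter (fun q => q.2 = c)).card < p) :
    mn (A.map (shA t)) = t + mn A := by
  have himg : (A.map (shA t)).image Prod.snd = A.image Prod.snd := by
    ext c; simp [shA_apply]
  have hne : (A.image Prod.snd).Nonempty := hA.image _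
  unfold mn
  simp only [himg]
  rw [dif_pos hne, dif_pos hne]
  have hmem := Finset.min'_mem _ hne
  generalize (A.image Prod.snd).min' hne = c at hmem ⊢
  have hf : (A.map (shA t)).filter (fun q => q.2 = c) = (A.filter (fun q => q.2 = c)).map (shA t) := by
    rw [Finset.filter_map]; rfl
  rw [hf, Finset.sum_map, Finset.card_map]
  simp only [shA_apply, Finset.sum_add_distrib, Finset.sum_const, nsmul_eq_mul]
  have h0 : ((A.filter (fun q => q.2 = c)).card : ZMod p) ≠ 0 := by
    intro h
    rw [ZMod.natCast_eq_zero_iff] at h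
    have hpos : 0 < (A.filter (fun q => q.2 = c)).card := by
      obtain ⟨q, hq, rfl⟩ := Finset.mem_image.1 hmem
      exact Finset.card_pos.2 ⟨q, by simp [hq]⟩
    exact absurd (Nat.le_of_dvd hpos h) (not_le.2 (hc c))
  field_simp

theorem core {V : Type*} [Fintype V] [DecidableEq V] (n r p C : ℕ) (hr : 2 ≤ r)
    [Fact p.Prime] (hrp : r ≤ p) (E : Set (Finset V)) (hne : ∀ e ∈ E, e.Nonempty)
    (σ : Fin n ≃ V) (col : {e : Finset V // e ∈ E} → Fin C)
    (hcol : ∀ S ∈ KGEdges E r, ∃ e ∈ S, ∃ f ∈ S, col e ≠ col f) :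
    n ≤ altSigma E p σ + C * (r - 1) := by
  classical
  by_contra hcon
  push Not at hcon
  let A : PV n p → Finset (ZMod p × Fin C) := fun X => Finset.univ.filter
    (fun q => ∃ e : {e : Finset V // e ∈ E}, col e = q.2 ∧ (e.1 : Set V) ⊆ σ '' {i | X.1 i = some q.1})
  have hA : ∀ X q, q ∈ A X ↔ ∃ e : {e : Finset V // e ∈ E}, col e = q.2 ∧
      (e.1 : Set V) ⊆ σ '' {i | X.1 i = some q.1} := by
    intro X q; simp [A]
  have hAmono : ∀ X Y, X ≤ Y → A X ⊆ A Y := by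
    intro X Y h q hq
    rw [hA] at hq ⊢
    obtain ⟨e, he, hs⟩ := hq
    refine ⟨e, he, hs.trans (Set.image_mono ?_)⟩
    intro i hi
    have hi' : X.1 i = some q.1 := hi
    have := h i (by rw [hi']; simp)
    exact this.trans hi'
  have hAsh : ∀ t X, A (actV t X) = (A X).map (shA t) := by
    intro t X
    ext q
    have hset : ∀ a, {i | (actV t X).1 i = some (t + a)} = {i | X.1 i = some a} := by
      intro a; ext i; exact shV_some t X.1 i a
    rw [Finset.mem_map]
    constructor
    · intro hq
      refine ⟨(-t + q.1, q.2), ?_, by simp [shA_apply]⟩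
      rw [hA] at hq ⊢
      obtain ⟨e, he, hs⟩ := hq
      refine ⟨e, he, ?_⟩
      rw [← hset]
      simpa using hs
    · rintro ⟨q', hq', rfl⟩
      rw [hA] at hq' ⊢
      obtain ⟨e, he, hs⟩ := hq'
      refine ⟨e, he, ?_⟩
      rw [shA_apply]
      have h2 := hset q'.1
      rw [← h2] at hs
      exact hs
  have hfib : ∀ X c, ((A X).filter (fun q => q.2 = c)).card ≤ r - 1 := by
    intro X c
    by_contra hlt
    push Not at hlt
    obtain ⟨T, hT, hTc⟩ := Finset.exists_subset_card_eq (show r ≤ ((A X).filter (fun q => q.2 = c)).card by omega)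
    have hex : ∀ q : T, ∃ e : {e : Finset V // e ∈ E}, col e = c ∧
        (e.1 : Set V) ⊆ σ '' {i | X.1 i = some q.1.1} := by
      rintro ⟨q, hq⟩
      have := hT hq
      rw [Finset.mem_filter, hA] at this
      obtain ⟨⟨e, he, hs⟩, hqc⟩ := this
      exact ⟨e, he.trans hqc, hs⟩
    choose g hg1 hg2 using hex
    have hdisj : ∀ a b : T, a ≠ b → Disjoint (g a).1 (g b).1 := by
      intro a b hab
      rw [Finset.disjoint_left]
      intro v hva hvb
      obtain ⟨i, hi, hiv⟩ := hg2 a hva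
      obtain ⟨j, hj, hjv⟩ := hg2 b hvb
      have hij : i = j := σ.injective (hiv.trans hjv.symm)
      subst hij
      have e1 : a.1.1 = b.1.1 := Option.some_injective _ (Eq.trans (Eq.symm hi) hj)
      have ha := (Finset.mem_filter.1 (hT a.2)).2
      have hb := (Finset.mem_filter.1 (hT b.2)).2
      exact hab (Subtype.ext (Prod.ext e1 (ha.trans hb.symm)))
    have hinj : Function.Injective g := by
      intro a b hab
      by_contra hne'
      have h1 := hdisj a b hne'
      rw [hab, disjoint_self] at h1
      have h2 := hne _ (g b).2
      simp [h1] at h2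
    obtain ⟨e, he, f, hf, hef⟩ := hcol (Finset.univ.map ⟨g, hinj⟩) (by
      refine ⟨by simp [hTc], ?_⟩
      intro e he f hf hef
      simp only [Finset.mem_map, Finset.mem_univ, true_and, Function.Embedding.coeFn_mk] at he hf
      obtain ⟨a, rfl⟩ := he
      obtain ⟨b, rfl⟩ := hf
      exact hdisj a b (fun h => hef (by rw [h])))
    simp only [Finset.mem_map, Finset.mem_univ, true_and, Function.Embedding.coeFn_mk] at he hf
    obtain ⟨a, rfl⟩ := he
    obtain ⟨b, rfl⟩ := hf
    exact hef ((hg1 a).trans (hg1 b).symm)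
  have hAcard : ∀ X, (A X).card ≤ C * (r - 1) := by
    intro X
    have h1 := Finset.card_le_mul_card_image (f := Prod.snd) (A X) (r - 1) (fun c _ => hfib X c)
    have h2 : ((A X).image Prod.snd).card ≤ C := by
      simpa using Finset.card_le_univ ((A X).image Prod.snd)
    calc _ ≤ _ := h1
      _ ≤ (r - 1) * C := Nat.mul_le_mul_left _ h2
      _ = _ := Nat.mul_comm _ _
  have hempty : ∀ X, A X = ∅ → altVec X.1 ≤ altSigma E p σ := by
    intro X hX
    apply le_csSup
    · refine ⟨n, ?_⟩
      rintro a ⟨Y, rfl, _⟩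
      exact altVec_le Y
    · refine ⟨X.1, rfl, ?_⟩
      intro ε e he hs
      have : (ε, col ⟨e, he⟩) ∈ A X := (hA _ _).2 ⟨⟨e, he⟩, rfl, hs⟩
      simp [hX] at this
  have hfirst : ∀ X : PV n p, ∃ a : ZMod p, ∃ i, X.1 i = some a ∧ ∀ k < i, X.1 k = none := by
    intro X
    have hwf := wellFounded_lt (α := Fin n)
    let S : Set (Fin n) := {i | X.1 i ≠ none}
    have hS : S.Nonempty := X.2
    have hm : X.1 (hwf.min S hS) ≠ none := hwf.min_mem S hS
    obtain ⟨a, ha⟩ := Option.ne_none_iff_exists'.1 hm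
    refine ⟨a, _, ha, fun k hk => ?_⟩
    by_contra hk'
    exact hwf.not_lt_min S hk' hk
  choose fs fi hfs hfs' using hfirst
  let s : PV n p → ZMod p := fun X => if A X = ∅ then fs X else mn (A X)
  let l : PV n p → ℕ := fun X => if A X = ∅ then altVec X.1 else altSigma E p σ + (A X).card
  have hs1 : ∀ X, A X = ∅ → s X = fs X := fun X h => if_pos h
  have hs2 : ∀ X, A X ≠ ∅ → s X = mn (A X) := fun X h => if_neg h
  have hl1 : ∀ X, A X = ∅ → l X = altVec X.1 := fun X h => if_pos h
  have hl2 : ∀ X, A X ≠ ∅ → l X = altSigma E p σ + (A X).card := fun X h => if_neg h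
  have hcp : ∀ X, A X ≠ ∅ → 0 < (A X).card := fun X h =>
    Finset.card_pos.2 (Finset.nonempty_iff_ne_empty.2 h)
  refine tucker_conc _ hcon s ?_ l ?_ ?_ ?_ ?_
  · intro t X
    by_cases h : A X = ∅
    · have h' : A (actV t X) = ∅ := by rw [hAsh, h]; simp
      rw [hs1 _ h, hs1 _ h']
      have e1 : fi X = fi (actV t X) := by
        rcases lt_trichotomy (fi X) (fi (actV t X)) with hlt | heq | hlt
        · have := hfs' (actV t X) _ hlt
          have h2 := (shV_some t X.1 _ _).2 (hfs X)
          exact absurd (h2.symm.trans this) (by simp)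
        · exact heq
        · have := hfs' X _ hlt
          have h2 : shV t X.1 (fi (actV t X)) ≠ none := by
            have : shV t X.1 (fi (actV t X)) = _ := hfs (actV t X)
            rw [this]; simp
          exact absurd this ((shV_ne _ _ _).1 h2)
      have h2 := (shV_some t X.1 _ _).2 (hfs X)
      rw [e1] at h2
      exact Option.some_injective _ ((hfs (actV t X)).symm.trans h2)
    · have h' : A (actV t X) ≠ ∅ := by rw [hAsh]; simpa using h
      rw [hs2 _ h, hs2 _ h', hAsh]
      apply mn_shift _ _ (Finset.nonempty_iff_ne_empty.2 h)
      intro c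
      have := hfib X c
      omega
  · intro X Y hXY
    have hsub := hAmono X Y hXY
    by_cases hX : A X = ∅
    · rw [hl1 X hX]
      by_cases hY : A Y = ∅
      · rw [hl1 Y hY]; exact altVec_mono hXY
      · rw [hl2 Y hY]
        exact (hempty X hX).trans (Nat.le_add_right _ _)
    · have hY : A Y ≠ ∅ := by
        intro h; rw [h] at hsub; exact hX (Finset.subset_empty.1 hsub)
      rw [hl2 X hX, hl2 Y hY]
      have := Finset.card_le_card hsub
      omega
  · intro X
    by_cases hX : A X = ∅
    · rw [hl1 X hX]; exact altVec_pos X.2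
    · rw [hl2 X hX]; have := hcp X hX; omega
  · intro X
    by_cases hX : A X = ∅
    · rw [hl1 X hX]; exact (hempty X hX).trans (Nat.le_add_right _ _)
    · rw [hl2 X hX]; have := hAcard X; omega
  · intro X Y hXY hll
    have hsub := hAmono X Y hXY
    by_cases hX : A X = ∅
    · rw [hl1 X hX] at hll
      by_cases hY : A Y = ∅
      · rw [hl1 Y hY] at hll
        rw [hs1 X hX, hs1 Y hY]
        exact first_sign hXY X.2 hll _ _ _ _ (hfs X) (hfs' X) (hfs Y) (hfs' Y)
      · rw [hl2 Y hY] at hll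
        have h1 := hempty X hX
        have h2 := hcp Y hY
        omega
    · have hY : A Y ≠ ∅ := by
        intro h; rw [h] at hsub; exact hX (Finset.subset_empty.1 hsub)
      rw [hl2 X hX, hl2 Y hY] at hll
      have : A X = A Y := Finset.eq_of_subset_of_card_le hsub (by omega)
      rw [hs2 X hX, hs2 Y hY, this]

end KnTucker

/-- **Alishahi–Hajiabolhassan bound:** if `KG^r(F)` has finite chromatic number then
`χ(KG^r(F)) ≥ ⌈(|V(F)| − alt_p(F)) / (r − 1)⌉` (the ceiling of `x / (r-1)` is
written as `(x + r - 2) / (r - 1)` in natural number arithmetic). -/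
theorem chromatic_kneser_ge_alt {V : Type*} [Fintype V] [DecidableEq V]
    (r p : ℕ) (hr : 2 ≤ r) (hp : p.Prime) (hrp : r ≤ p)
    (E : Set (Finset V)) (hne : ∀ e ∈ E, e.Nonempty)
    (hfin : ∃ C, ∃ c : {e : Finset V // e ∈ E} → Fin C,
      ∀ S ∈ KGEdges E r, ∃ e ∈ S, ∃ f ∈ S, c e ≠ c f) :
    (Fintype.card V - altHyp E p + r - 2) / (r - 1) ≤ chrHyp (KGEdges E r) := by
  have : Fact p.Prime := ⟨hp⟩
  obtain ⟨c, hc⟩ : ∃ c : {e : Finset V // e ∈ E} → Fin (chrHyp (KGEdges E r)),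
      ∀ S ∈ KGEdges E r, ∃ e ∈ S, ∃ f ∈ S, c e ≠ c f := Nat.sInf_mem hfin
  obtain ⟨σ, hσ⟩ : ∃ σ : Fin (Fintype.card V) ≃ V, altHyp E p = altSigma E p σ :=
    Nat.sInf_mem (s := {a | ∃ σ : Fin (Fintype.card V) ≃ V, a = altSigma E p σ})
      ⟨_, (Fintype.equivFin V).symm, rfl⟩
  have h := KnTucker.core (Fintype.card V) r p _ hr hrp E hne σ c hc
  rw [← hσ] at h
  generalize chrHyp (KGEdges E r) = C at h
  apply Nat.le_of_lt_succ
  rw [Nat.div_lt_iff_lt_mul (by omega), Nat.succ_mul]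
  omega
end

section
/- Let r ≥ 2 be an integer, p ≥ r a prime, and F a hypergraph with n vertices that contains p pairwise vertex-disjoint edges (so that the clique number of KG^r(F) is at least p). Then Xind_{Z_p}(Hom(K^r_p, KG^r(F))) + p ≥ n − alt_p(F). -/
/-- Elements of the `Z_p`-hom-complex `Hom(K^r_p, H)`. -/
def HomElem {W : Type*} [DecidableEq W] (Eh : Set (Finset W)) (r p : ℕ)
    (U : ZMod p → Finset W) : Prop :=
  (∀ i, (U i).Nonempty) ∧ (∀ i j, i ≠ j → Disjoint (U i) (U j)) ∧
    SpansComplete Eh r U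

/-- The cross-index `Xind_{Z_p}(Hom(K^r_p, H))`. -/
noncomputable def XindHom {W : Type*} [DecidableEq W] (Eh : Set (Finset W)) (r p : ℕ) : ℕ :=
  sInf {n | ∃ φ : (ZMod p → Finset W) → ZMod p × Fin (n + 1),
    (∀ x y, HomElem Eh r p x → HomElem Eh r p y → (∀ i, x i ⊆ y i) →
      ((φ x).2 < (φ y).2 ∨ φ x = φ y)) ∧
    (∀ (ε : ZMod p) (x), HomElem Eh r p x →
      φ (fun i => x (i + ε)) = (ε + (φ x).1, (φ x).2))}

/-! ### Algebra: chains of lists -/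

namespace XK

open Finsupp

abbrev Ch (p : ℕ) (P : Type*) := List P →₀ ZMod p

variable {p : ℕ} {P Q : Type*}

noncomputable def consL (x : P) : Ch p P →ₗ[ZMod p] Ch p P :=
  Finsupp.lmapDomain _ _ (List.cons x)

noncomputable def bdl : List P → Ch p P
  | [] => 0
  | x :: l => single l 1 - consL x (bdl l)

noncomputable def bd : Ch p P →ₗ[ZMod p] Ch p P := Finsupp.linearCombination (ZMod p) bdl

noncomputable def mapL (h : P → Q) : Ch p P →ₗ[ZMod p] Ch p Q :=
  Finsupp.lmapDomain _ _ (List.map h)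

@[simp] lemma consL_single (x : P) (l : List P) (a : ZMod p) :
    consL x (single l a) = single (x :: l) a := by simp [consL]

@[simp] lemma mapL_single (h : P → Q) (l : List P) (a : ZMod p) :
    mapL h (single l a) = single (l.map h) a := by simp [mapL]

@[simp] lemma bd_single (l : List P) : bd (single l (1 : ZMod p)) = bdl l := by simp [bd]

lemma lin_ext {M : Type*} [AddCommMonoid M] [Module (ZMod p) M] {f g : Ch p P →ₗ[ZMod p] M}
    (h : ∀ l, f (single l 1) = g (single l 1)) (z : Ch p P) : f z = g z := by
  have : f = g := by
    apply Finsupp.lhom_ext'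
    intro l
    ext
    simpa using h l
  rw [this]

lemma bd_cons (x : P) (z : Ch p P) : bd (consL x z) = z - consL x (bd z) := by
  refine lin_ext (f := bd ∘ₗ consL x) (g := LinearMap.id - consL x ∘ₗ bd) ?_ z
  intro l
  simp [bdl]

lemma mapL_consL (h : P → Q) (x : P) (z : Ch p P) :
    mapL h (consL x z) = consL (h x) (mapL h z) := by
  refine lin_ext (f := mapL h ∘ₗ consL x) (g := consL (h x) ∘ₗ mapL h) ?_ z
  intro l
  simp

lemma bd_mapL (h : P → Q) (z : Ch p P) : bd (mapL h z) = mapL h (bd z) := by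
  refine lin_ext (f := bd ∘ₗ mapL h) (g := mapL h ∘ₗ bd) ?_ z
  intro l
  induction l with
  | nil => simp [bdl]
  | cons x l ih =>
    simp only [LinearMap.comp_apply, mapL_single, bd_single] at ih ⊢
    simp [bdl, mapL_consL, ih]

lemma mapL_mapL {S : Type*} (h : P → Q) (k : Q → S) (z : Ch p P) :
    mapL k (mapL h z) = mapL (k ∘ h) z := by
  refine lin_ext (f := mapL k ∘ₗ mapL h) (g := mapL (k ∘ h)) ?_ z
  intro l
  simp

/-- insertion, the non-initial positions -/
noncomputable def hl (j : P → P) : List P → Ch p P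
  | [] => 0
  | x :: l => single (x :: j x :: l.map j) 1 - consL x (hl j l)

noncomputable def hL (j : P → P) : Ch p P →ₗ[ZMod p] Ch p P :=
  Finsupp.linearCombination (ZMod p) (hl j)

@[simp] lemma hL_single (j : P → P) (l : List P) : hL j (single l (1 : ZMod p)) = hl j l := by
  simp [hL]

lemma hL_cons (j : P → P) (x : P) (z : Ch p P) :
    hL j (consL x z) = consL x (consL (j x) (mapL j z)) - consL x (hL j z) := by
  refine lin_ext (f := hL j ∘ₗ consL x)
    (g := consL x ∘ₗ consL (j x) ∘ₗ mapL j - consL x ∘ₗ hL j) ?_ z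
  intro l
  simp [hl]

/-- full insertion -/
noncomputable def kL (j : P → P) (y : P) : Ch p P →ₗ[ZMod p] Ch p P :=
  consL y ∘ₗ mapL j - hL j

lemma bd_hL (j : P → P) (z : Ch p P) :
    bd (hL j z) = mapL j z - z - hL j (bd z) := by
  refine lin_ext (f := bd ∘ₗ hL j) (g := mapL j - LinearMap.id - hL j ∘ₗ bd) ?_ z
  intro l
  induction l with
  | nil => simp [hl, bdl]
  | cons x l ih =>
    simp only [LinearMap.comp_apply, LinearMap.sub_apply, LinearMap.id_apply, mapL_single,
      bd_single, hL_single] at ih ⊢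
    have e1 : mapL j (bdl l) = (bdl (l.map j) : Ch p P) := by
      rw [← bd_single, ← bd_mapL]; simp
    simp only [hl, bdl, map_sub, bd_cons, ih, hL_cons, bd_single, hL_single, consL_single, e1,
      List.map_cons]
    abel

lemma bd_kL (j : P → P) (y : P) (z : Ch p P) : bd (kL j y z) = z - kL j y (bd z) := by
  simp only [kL, LinearMap.sub_apply, LinearMap.comp_apply, map_sub, bd_cons, bd_hL, bd_mapL]
  abel

/-! carry -/

def carry (u v : ZMod p) : ℕ := (u.val + v.val) / p

lemma carry_spec [NeZero p] (u v : ZMod p) : u.val + v.val = (u + v).val + p * carry u v := by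
  rw [ZMod.val_add, carry, Nat.mod_add_div]

lemma carry_cocycle [NeZero p] (u v w : ZMod p) :
    carry v w + carry u (v + w) = carry (u + v) w + carry u v := by
  have h1 := carry_spec v w
  have h2 := carry_spec u (v + w)
  have h3 := carry_spec (u + v) w
  have h4 := carry_spec u v
  rw [← add_assoc] at h2
  have hp : 0 < p := Nat.pos_of_ne_zero (NeZero.ne p)
  apply Nat.eq_of_mul_eq_mul_left hp
  rw [mul_add, mul_add]
  omega

lemma carry_sum [NeZero p] (v : ZMod p) : ∑ u : ZMod p, carry u v = v.val := by
  have hp : 0 < p := Nat.pos_of_ne_zero (NeZero.ne p)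
  apply Nat.eq_of_mul_eq_mul_left hp
  have h : ∑ u : ZMod p, (u.val + v.val) = ∑ u : ZMod p, ((u + v).val + p * carry u v) :=
    Finset.sum_congr rfl fun u _ => carry_spec u v
  rw [Finset.sum_add_distrib, Finset.sum_add_distrib, ← Finset.mul_sum] at h
  have h2 : ∑ u : ZMod p, (u + v).val = ∑ u : ZMod p, u.val :=
    Fintype.sum_equiv (Equiv.addRight v) _ _ (fun u => rfl)
  rw [h2] at h
  have h3 : ∑ u : ZMod p, v.val = p * v.val := by simp [ZMod.card]
  omega

lemma carry_zero_left [NeZero p] (v : ZMod p) : carry 0 v = 0 := by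
  simp [carry, ZMod.val_lt]

lemma carry_zero_right [NeZero p] (v : ZMod p) : carry v 0 = 0 := by
  simp [carry, ZMod.val_lt]

def be (x y z : ZMod p) : ZMod p := (carry (y - x) (z - y) : ℕ)

lemma be_cocycle [NeZero p] (x y z w : ZMod p) :
    be y z w - be x z w + be x y w - be x y z = 0 := by
  have h := carry_cocycle (y - x) (z - y) (w - z)
  have h' := congrArg (Nat.cast : ℕ → ZMod p) h
  push_cast at h'
  have e1 : z - y + (w - z) = w - y := by ring
  have e2 : y - x + (z - y) = z - x := by ring
  rw [e1, e2] at h'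
  simp only [be]
  linear_combination h'

def Ev : List (ZMod p) → ZMod p
  | [] => 0
  | [_] => 1
  | [_, _] => 0
  | x :: y :: z :: l => be x y z * Ev (z :: l)

def Od : List (ZMod p) → ZMod p
  | [] => 0
  | [_] => 0
  | x :: y :: l => (y - x) * Ev (y :: l)

def Gd : List (ZMod p) → ZMod p
  | [] => 0
  | x :: l => x * Ev (x :: l)

def sh (a : ZMod p) (l : List (ZMod p)) : List (ZMod p) := l.map (a + ·)

lemma Ev_shift (a : ZMod p) : ∀ l : List (ZMod p), Ev (l.map (a + ·)) = Ev l
  | [] => rfl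
  | [_] => rfl
  | [_, _] => rfl
  | x :: y :: z :: l => by
    have := Ev_shift a (z :: l)
    simp only [List.map_cons] at this ⊢
    simp [Ev, be, this]

noncomputable def ev (F : List (ZMod p) → ZMod p) : Ch p (ZMod p) →ₗ[ZMod p] ZMod p :=
  Finsupp.linearCombination (ZMod p) F

@[simp] lemma ev_single (F : List (ZMod p) → ZMod p) (l) : ev F (single l 1) = F l := by
  simp [ev]

lemma ev_be (x y z : ZMod p) (c : Ch p (ZMod p)) :
    ev Ev (consL x (consL y (consL z c))) = be x y z * ev Ev (consL z c) := by
  refine lin_ext (f := ev Ev ∘ₗ consL x ∘ₗ consL y ∘ₗ consL z)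
    (g := be x y z • (ev Ev ∘ₗ consL z)) ?_ c
  intro l
  simp [Ev]

lemma Ev_bd_list [NeZero p] : ∀ l : List (ZMod p), ev Ev (bdl l) = 0
  | [] => by simp [bdl]
  | [x] => by simp [bdl, Ev]
  | [x, y] => by simp [bdl, Ev]
  | x :: y :: z :: l => by
    have ih := Ev_bd_list (z :: l)
    simp only [bdl, map_sub, ev_be, ev_single, consL_single] at ih ⊢
    have h1 : ev Ev (consL z (bdl l)) = Ev l := by linear_combination -ih
    rw [h1]
    cases l with
    | nil => simp [Ev]
    | cons w m =>
      simp only [Ev]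
      linear_combination (Ev (w :: m)) * be_cocycle x y z w

lemma Ev_bd [NeZero p] (z : Ch p (ZMod p)) : ev Ev (bd z) = 0 := by
  refine lin_ext (f := ev Ev ∘ₗ bd) (g := 0) ?_ z
  intro l
  simp [Ev_bd_list]

lemma Ev_cons0 [NeZero p] (a : ZMod p) (z : Ch p (ZMod p)) : ev Ev (consL a (bd z)) = ev Ev z := by
  have := Ev_bd (consL a z)
  rw [bd_cons, map_sub] at this
  linear_combination -this

lemma Gd_cons (x : ZMod p) (z : Ch p (ZMod p)) : ev Gd (consL x z) = x * ev Ev (consL x z) := by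
  refine lin_ext (f := ev Gd ∘ₗ consL x) (g := x • (ev Ev ∘ₗ consL x)) ?_ z
  intro l
  simp [Gd]

lemma Gd_bd [NeZero p] (z : Ch p (ZMod p)) : ev Gd (bd z) = ev Od z := by
  refine lin_ext (f := ev Gd ∘ₗ bd) (g := ev Od) ?_ z
  intro l
  match l with
  | [] => simp [bdl, Od]
  | [x] => simp [bdl, Od, Gd]
  | x :: y :: l =>
    have := Ev_cons0 x (single (y :: l) 1)
    simp only [bd_single, ev_single] at this
    simp only [LinearMap.comp_apply, bd_single, ev_single]
    rw [bdl, map_sub, Gd_cons, this]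
    simp [Gd, Od]
    ring

lemma Gd_T (z : Ch p (ZMod p)) : ev Gd (mapL (1 + ·) z - z) = ev Ev z := by
  refine lin_ext (f := ev Gd ∘ₗ (mapL (1 + ·) - LinearMap.id)) (g := ev Ev) ?_ z
  intro l
  match l with
  | [] => simp [Ev]
  | x :: l =>
    have := Ev_shift 1 (x :: l)
    simp only [List.map_cons] at this
    simp [Gd, this]
    ring

lemma Ev_N [NeZero p] (z : Ch p (ZMod p)) :
    ev Ev (consL 0 (∑ a : ZMod p, mapL (a + ·) z)) = ev Od z := by
  have key := lin_ext (f := ev Ev ∘ₗ consL 0 ∘ₗ (∑ a : ZMod p, mapL (a + ·))) (g := ev Od) ?_ z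
  · rw [← key]
    simp
  intro l
  simp only [LinearMap.comp_apply, LinearMap.sum_apply, mapL_single, map_sum, consL_single,
    ev_single]
  match l with
  | [] => simp [Ev, Od, ZMod.card]
  | [x] => simp [Ev, Od]
  | x :: y :: l =>
    have h : ∀ a : ZMod p, Ev (0 :: List.map (a + ·) (x :: y :: l)) =
        (carry (a + x) (y - x) : ℕ) * Ev (y :: l) := by
      intro a
      have := Ev_shift a (y :: l)
      simp only [List.map_cons] at this ⊢
      simp [Ev, this, be]
    rw [Finset.sum_congr rfl fun a _ => h a, ← Finset.sum_mul]
    have h2 : ∑ a : ZMod p, ((carry (a + x) (y - x) : ℕ) : ZMod p)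
        = ∑ u : ZMod p, ((carry u (y - x) : ℕ) : ZMod p) :=
      Fintype.sum_equiv (Equiv.addRight x) _ _ (fun u => rfl)
    rw [h2, ← Nat.cast_sum, carry_sum]
    simp [Od]

lemma Ev_ne_zero [NeZero p] : ∀ l : List (ZMod p), Ev l ≠ 0 → l.IsChain (· ≠ ·)
  | [] => by simp
  | [_] => by simp
  | [_, _] => by simp [Ev]
  | x :: y :: z :: l => by
    intro h
    have h1 : Ev (z :: l) ≠ 0 := fun h' => h (by simp [Ev, h'])
    have h2 : be x y z ≠ 0 := fun h' => h (by simp [Ev, h'])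
    have ih := Ev_ne_zero (z :: l) h1
    refine List.IsChain.cons_cons ?_ (List.IsChain.cons_cons ?_ ih)
    · rintro rfl; simp [be, carry_zero_left] at h2
    · rintro rfl; simp [be, carry_zero_right] at h2

lemma Od_ne_zero [NeZero p] (l : List (ZMod p)) (h : Od l ≠ 0) : l.IsChain (· ≠ ·) := by
  match l with
  | [] => simp
  | [_] => simp
  | x :: y :: l =>
    have h1 : Ev (y :: l) ≠ 0 := fun h' => h (by simp [Od, h'])
    refine List.IsChain.cons_cons ?_ (Ev_ne_zero _ h1)
    rintro rfl; simp [Od] at h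

/-! the test chains -/

noncomputable def TL [NeZero p] (act : ZMod p → P → P) (k : ℕ) : Ch p P →ₗ[ZMod p] Ch p P :=
  if Even k then mapL (act 1) - LinearMap.id else ∑ a : ZMod p, mapL (act a)

lemma bd_TL [NeZero p] (act : ZMod p → P → P) (k : ℕ) (z : Ch p P) :
    bd (TL act k z) = TL act k (bd z) := by
  unfold TL
  split_ifs <;> simp [LinearMap.sum_apply, bd_mapL]

lemma TL_TL [NeZero p] (act : ZMod p → P → P) (hact : ∀ a b x, act a (act b x) = act (a + b) x)
    (k : ℕ) (z : Ch p P) : TL act (k + 1) (TL act k z) = 0 := by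
  have hc : ∀ a b, act a ∘ act b = act (a + b) := fun a b => funext (hact a b)
  unfold TL
  by_cases h : Even k
  · have h' : ¬ Even (k + 1) := by simpa [Nat.even_add_one] using h
    simp only [h, h', if_true, if_false, LinearMap.sum_apply, LinearMap.sub_apply, map_sub,
      mapL_mapL, hc, LinearMap.id_apply]
    rw [sub_eq_zero]
    exact Fintype.sum_equiv (Equiv.addRight 1) _ _ (fun u => rfl)
  · have h' : Even (k + 1) := by simpa [Nat.even_add_one] using h
    simp only [h, h', if_true, if_false, LinearMap.sum_apply, LinearMap.sub_apply, map_sum,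
      mapL_mapL, hc, LinearMap.id_apply]
    rw [Finset.sum_sub_distrib, sub_eq_zero]
    exact Fintype.sum_equiv (Equiv.addLeft 1) _ _ (fun u => rfl)

noncomputable def cc [NeZero p] (act : ZMod p → P → P) (j : ℕ → P → P) (f : ℕ → P) : ℕ → Ch p P
  | 0 => single [f 0] 1
  | k + 1 => kL (j (k + 1)) (f (k + 1)) (TL act k (cc act j f k))

lemma bd_cc [NeZero p] (act : ZMod p → P → P) (hact : ∀ a b x, act a (act b x) = act (a + b) x)
    (j : ℕ → P → P) (f : ℕ → P) (k : ℕ) :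
    bd (cc act j f (k + 1)) = TL act k (cc act j f k) := by
  induction k with
  | zero =>
    have e : cc act j f (0 + 1) = kL (j 1) (f 1) (TL act 0 (cc act j f 0)) := rfl
    rw [e, bd_kL, bd_TL]; simp [cc, bdl, TL]
  | succ k ih =>
    rw [cc, bd_kL, bd_TL, ih, TL_TL act hact]; simp

lemma mapL_TL [NeZero p] (act : ZMod p → P → P) (el : P → ZMod p)
    (hel : ∀ a x, el (act a x) = a + el x) (k : ℕ) (z : Ch p P) :
    mapL el (TL act k z) = TL (fun a b => a + b) k (mapL el z) := by
  have h : ∀ a, el ∘ act a = (a + ·) ∘ el := fun a => funext (hel a)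
  unfold TL
  split_ifs <;> simp [LinearMap.sum_apply, mapL_mapL, h]

lemma cc_val [NeZero p] (act : ZMod p → P → P) (hact : ∀ a b x, act a (act b x) = act (a + b) x)
    (el : P → ZMod p) (hel : ∀ a x, el (act a x) = a + el x)
    (j : ℕ → P → P) (f : ℕ → P) (k : ℕ) :
    ev (if Even k then Ev else Od) (mapL el (cc act j f k)) = 1 := by
  induction k with
  | zero => simp [cc, Ev]
  | succ k ih =>
    have hb : bd (mapL el (cc act j f (k + 1)))
        = TL (fun a b => a + b) k (mapL el (cc act j f k)) := by
      rw [bd_mapL, bd_cc act hact, mapL_TL act el hel]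
    by_cases h : Even k
    · have h' : ¬ Even (k + 1) := by simpa [Nat.even_add_one] using h
      simp only [h, h', if_true, if_false] at ih ⊢
      rw [← Gd_bd, hb, ← ih, ← Gd_T]
      simp [TL, h]
    · have h' : Even (k + 1) := by simpa [Nat.even_add_one] using h
      simp only [h, h', if_true, if_false] at ih ⊢
      rw [← Ev_cons0 0, hb, ← ih, ← Ev_N]
      simp [TL, h, LinearMap.sum_apply]

lemma exists_list [NeZero p] (hp1 : 1 < p) (act : ZMod p → P → P)
    (hact : ∀ a b x, act a (act b x) = act (a + b) x)
    (el : P → ZMod p) (hel : ∀ a x, el (act a x) = a + el x)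
    (j : ℕ → P → P) (f : ℕ → P) (k : ℕ) :
    ∃ l ∈ (cc act j f k).support, (l.map el).IsChain (· ≠ ·) := by
  have : Fact (1 < p) := ⟨hp1⟩
  by_contra hcon
  push Not at hcon
  have hv := cc_val act hact el hel j f k
  have : ev (if Even k then Ev else Od) (mapL el (cc act j f k)) = 0 := by
    have e : ev (if Even k then Ev else Od) (mapL el (cc act j f k)) =
        (cc act j f k).sum fun l a => a * (if Even k then Ev else Od) (l.map el) := by
      have := (lin_ext (f := Finsupp.linearCombination (ZMod p)
        (fun l : List P => (if Even k then Ev else Od) (l.map el)))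
        (g := ev (if Even k then Ev else Od) ∘ₗ mapL el) (by intro l; simp) (cc act j f k)).symm
      exact this
    rw [e]
    apply Finset.sum_eq_zero
    intro l hl
    have h := hcon l hl
    have : (if Even k then Ev else Od) (l.map el) = 0 := by
      by_contra h0
      apply h
      split_ifs at h0
      · exact Ev_ne_zero _ h0
      · exact Od_ne_zero _ h0
    simp [this]
  rw [this] at hv
  exact zero_ne_one hv

/-! supports -/

lemma supp_lin {S : Set (List P)} {S' : Set (List Q)} (F : Ch p P →ₗ[ZMod p] Ch p Q)
    (h : ∀ l ∈ S, F (single l 1) ∈ supported (ZMod p) (ZMod p) S') {z : Ch p P}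
    (hz : z ∈ supported (ZMod p) (ZMod p) S) : F z ∈ supported (ZMod p) (ZMod p) S' := by
  have hz' := hz
  rw [supported_eq_span_single] at hz'
  induction hz' using Submodule.span_induction with
  | mem x hx => obtain ⟨l, hl, rfl⟩ := hx; exact h l hl
  | zero => simp
  | add x y hx hy h1 h2 =>
    rw [← supported_eq_span_single] at hx hy
    rw [map_add]; exact Submodule.add_mem _ (h1 hx) (h2 hy)
  | smul a x hx h1 =>
    rw [← supported_eq_span_single] at hx
    rw [map_smul]; exact Submodule.smul_mem _ _ (h1 hx)

lemma supp_single {S : Set (List P)} {l : List P} (h : l ∈ S) :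
    (single l 1 : Ch p P) ∈ supported (ZMod p) (ZMod p) S := single_mem_supported _ _ h

lemma supp_hl (le : P → P → Prop) (j : P → P) (V : P → Prop)
    (h1 : ∀ x, V x → le x (j x)) (h2 : ∀ x y, le x y → le (j x) (j y)) (l : List P)
    (hV : ∀ x ∈ l, V x) (hc : l.IsChain le) :
    (hl j l : Ch p P) ∈ supported (ZMod p) (ZMod p)
      {m | m.length = l.length + 1 ∧ m.IsChain le ∧ m.head? = l.head? ∧
        ∀ y ∈ m, ∃ x ∈ l, y = x ∨ y = j x} := by
  induction l with
  | nil => simp [hl]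
  | cons x l ih =>
    rw [hl]
    apply Submodule.sub_mem
    · apply supp_single
      refine ⟨by simp, ?_, rfl, ?_⟩
      · refine List.IsChain.cons_cons (h1 x (hV x (by simp))) ?_
        have := List.isChain_map_of_isChain (S := le) j (fun a b => h2 a b) hc
        simpa using this
      · intro y hy
        simp only [List.mem_cons, List.mem_map] at hy
        rcases hy with rfl | rfl | ⟨a, ha, rfl⟩
        · exact ⟨y, by simp, Or.inl rfl⟩
        · exact ⟨x, by simp, Or.inr rfl⟩
        · exact ⟨a, by simp [ha], Or.inr rfl⟩
    · refine supp_lin (consL x) ?_ (ih (fun y hy => hV y (by simp [hy])) hc.of_cons)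
      rintro m ⟨m1, m2, m3, m4⟩
      rw [consL_single]
      apply supp_single
      refine ⟨by simp [m1], ?_, rfl, ?_⟩
      · rw [List.isChain_cons] at hc ⊢
        rw [m3]
        exact ⟨hc.1, m2⟩
      · intro y hy
        rcases List.mem_cons.1 hy with rfl | hy
        · exact ⟨y, by simp, Or.inl rfl⟩
        · obtain ⟨a, ha, hh⟩ := m4 y hy
          exact ⟨a, by simp [ha], hh⟩

/-- the lists in `cc k` are chains of length `k+1`. -/
lemma supp_cc [NeZero p] (act : ZMod p → P → P) (j : ℕ → P → P) (f : ℕ → P)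
    (le : P → P → Prop) (n : ℕ) (V : ℕ → P → Prop)
    (h1 : ∀ k < n, ∀ x, V k x → le x (j k x))
    (h2 : ∀ k x y, le x y → le (j k x) (j k y))
    (h3 : ∀ k x, le (f k) (j k x))
    (h4 : ∀ k, k < n → ∀ x, V k x → V (k + 1) x ∧ V (k + 1) (j k x))
    (h5 : ∀ k, k < n → V (k + 1) (f k))
    (h6 : ∀ a k x, V k x → V k (act a x))
    (h7 : ∀ a x y, le x y → le (act a x) (act a y)) (k : ℕ) (hk : k < n) :
    cc act j f k ∈ supported (ZMod p) (ZMod p)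
      {m | m.length = k + 1 ∧ m.IsChain le ∧ ∀ y ∈ m, V (k + 1) y} := by
  induction k with
  | zero => exact supp_single (by simp [h5 0 hk])
  | succ k ih =>
    have ih := ih (by omega)
    have hm : ∀ a, mapL (act a) (cc act j f k) ∈ supported (ZMod p) (ZMod p)
      {m | m.length = k + 1 ∧ m.IsChain le ∧ ∀ y ∈ m, V (k + 1) y} := by
      intro a
      refine supp_lin _ ?_ ih
      rintro l ⟨l1, l2, l3⟩
      rw [mapL_single]
      refine supp_single ⟨by simp [l1], List.isChain_map_of_isChain (S := le) _ (h7 a) l2, ?_⟩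
      intro y hy
      obtain ⟨x, hx, rfl⟩ := List.mem_map.1 hy
      exact h6 _ _ _ (l3 x hx)
    have hT : TL act k (cc act j f k) ∈ supported (ZMod p) (ZMod p)
      {m | m.length = k + 1 ∧ m.IsChain le ∧ ∀ y ∈ m, V (k + 1) y} := by
      unfold TL
      split_ifs
      · exact Submodule.sub_mem _ (hm 1) ih
      · rw [LinearMap.sum_apply]
        exact Submodule.sum_mem _ fun a _ => hm a
    rw [cc]
    refine supp_lin _ ?_ hT
    rintro l ⟨l1, l2, l3⟩
    rw [kL, LinearMap.sub_apply]
    apply Submodule.sub_mem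
    · simp only [LinearMap.comp_apply, mapL_single, consL_single]
      refine supp_single ⟨by simp [l1], ?_, ?_⟩
      · rw [List.isChain_cons]
        refine ⟨?_, List.isChain_map_of_isChain (S := le) _ (h2 _) l2⟩
        intro y hy
        have := List.mem_of_mem_head? hy
        obtain ⟨x, hx, rfl⟩ := List.mem_map.1 this
        exact h3 _ _
      · intro y hy
        rcases List.mem_cons.1 hy with rfl | hy
        · exact h5 _ hk
        · obtain ⟨x, hx, rfl⟩ := List.mem_map.1 hy
          exact (h4 _ hk x (l3 x hx)).2
    · rw [hL_single]
      refine supported_mono ?_ (supp_hl le (j (k + 1)) (V (k + 1)) (h1 _ hk) (h2 _) l l3 l2)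
      rintro m ⟨m1, m2, m3, m4⟩
      refine ⟨by omega, m2, ?_⟩
      intro y hy
      obtain ⟨x, hx, rfl | rfl⟩ := m4 y hy
      · exact (h4 _ hk _ (l3 _ hx)).1
      · exact (h4 _ hk _ (l3 _ hx)).2

/-! Tucker-type lemma -/

abbrev Sg (n p : ℕ) := {X : Fin n → Option (ZMod p) // ∃ i, X i ≠ none}

def sle {n p : ℕ} (X Y : Fin n → Option (ZMod p)) : Prop := ∀ i, X i ≠ none → Y i = X i

def sact {n p : ℕ} (a : ZMod p) (X : Fin n → Option (ZMod p)) : Fin n → Option (ZMod p) :=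
  fun i => (X i).map (a + ·)

lemma sact_ne {n p : ℕ} (a : ZMod p) (X : Fin n → Option (ZMod p)) (i) :
    sact a X i ≠ none ↔ X i ≠ none := by simp [sact]

lemma tucker {n p N : ℕ} (hp1 : 1 < p) (el : (Fin n → Option (ZMod p)) → ZMod p)
    (lv : (Fin n → Option (ZMod p)) → ℕ)
    (hel : ∀ a X, (∃ i, X i ≠ none) → el (sact a X) = a + el X)
    (hmono : ∀ X Y, (∃ i, X i ≠ none) → (∃ i, Y i ≠ none) → sle X Y →
      lv X < lv Y ∨ el X = el Y)
    (hlv : ∀ X, (∃ i, X i ≠ none) → 1 ≤ lv X ∧ lv X ≤ N) : n ≤ N := by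
  have : NeZero p := ⟨by omega⟩
  rcases Nat.eq_zero_or_pos n with hn | hn
  · omega
  let act : ZMod p → Sg n p → Sg n p := fun a X =>
    ⟨sact a X.1, by obtain ⟨i, hi⟩ := X.2; exact ⟨i, (sact_ne _ _ _).2 hi⟩⟩
  let j : ℕ → Sg n p → Sg n p := fun k X =>
    ⟨fun i => if (i : ℕ) = k % n then some 0 else X.1 i,
      ⟨⟨k % n, Nat.mod_lt _ hn⟩, by simp⟩⟩
  let f : ℕ → Sg n p := fun k =>
    ⟨fun i => if (i : ℕ) = k % n then some 0 else none,
      ⟨⟨k % n, Nat.mod_lt _ hn⟩, by simp⟩⟩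
  let le : Sg n p → Sg n p → Prop := fun X Y => sle X.1 Y.1
  let V : ℕ → Sg n p → Prop := fun k X => ∀ i : Fin n, k ≤ i → X.1 i = none
  have hact : ∀ a b x, act a (act b x) = act (a + b) x := by
    intro a b x
    apply Subtype.ext
    funext i
    simp only [act, sact, Option.map_map]
    congr 1
    funext y
    simp [add_assoc]
  obtain ⟨l, hl, hch⟩ := exists_list hp1 act hact (fun X => el X.1)
    (fun a X => hel a X.1 X.2) j f (n - 1)
  have hs : cc act j f (n - 1) ∈ _ := supp_cc act j f le n V
    (by
      intro k hk x hx i hi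
      simp only [j]
      rw [if_neg]
      intro h
      rw [Nat.mod_eq_of_lt hk] at h
      exact hi (hx i h.ge))
    (by
      intro k x y h i hi
      simp only [j] at hi ⊢
      split_ifs at hi ⊢ with h'
      · rfl
      · exact h i hi)
    (by
      intro k x i hi
      simp only [j, f] at hi ⊢
      split_ifs at hi ⊢ with h'
      · rfl
      · exact absurd rfl hi)
    (by
      intro k hk x hx
      refine ⟨fun i hi => hx i (by omega), fun i hi => ?_⟩
      simp only [j]
      rw [if_neg]
      · exact hx i (by omega)
      · rw [Nat.mod_eq_of_lt hk]; omega)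
    (by
      intro k hk i hi
      simp only [f]
      rw [if_neg]
      rw [Nat.mod_eq_of_lt hk]; omega)
    (by
      intro a k x hx i hi
      simp [act, sact, hx i hi])
    (by
      intro a x y h i hi
      simp only [act, sact] at hi ⊢
      rw [h i]
      intro h0
      simp [h0] at hi)
    (n - 1) (by omega)
  obtain ⟨h1, h2, -⟩ := (mem_supported _ _).1 hs hl
  have h3 : (l.map fun X => lv X.1).IsChain (· < ·) := by
    rw [List.isChain_map] at hch ⊢
    rw [List.isChain_iff_getElem] at hch h2 ⊢
    intro i hi
    exact (hmono _ _ (l[i]).2 (l[i + 1]).2 (h2 i hi)).resolve_right (hch i hi)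
  have h4 : (l.map fun X => lv X.1).Nodup := by
    rw [List.isChain_iff_pairwise] at h3
    exact h3.imp (fun h => h.ne)
  have h5 : (l.map fun X => lv X.1).toFinset ⊆ Finset.Icc 1 N := by
    intro x hx
    simp only [List.mem_toFinset, List.mem_map] at hx
    obtain ⟨X, _, rfl⟩ := hx
    exact Finset.mem_Icc.2 (hlv _ X.2)
  have h6 := Finset.card_le_card h5
  rw [List.toFinset_card_of_nodup h4] at h6
  simp [h1] at h6
  omega

end XK
namespace XK

/-! alternation number -/

lemma hasAlt_le {n p m : ℕ} {X : Fin n → Option (ZMod p)} (h : HasAltSeq X m) : m ≤ n := by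
  obtain ⟨s, hs, -⟩ := h
  simpa using Fintype.card_le_of_injective s hs.injective

lemma hasAlt_bdd {n p : ℕ} (X : Fin n → Option (ZMod p)) : BddAbove {m | HasAltSeq X m} :=
  ⟨n, fun _ h => hasAlt_le h⟩

lemma hasAlt_zero {n p : ℕ} (X : Fin n → Option (ZMod p)) : HasAltSeq X 0 :=
  ⟨fun i => i.elim0, fun i => i.elim0, fun i => i.elim0, fun j h => by omega⟩

lemma hasAlt_altVec {n p : ℕ} (X : Fin n → Option (ZMod p)) : HasAltSeq X (altVec X) :=
  Nat.sSup_mem (s := {m | HasAltSeq X m}) ⟨0, hasAlt_zero X⟩ (hasAlt_bdd X)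

lemma le_altVec {n p m : ℕ} {X : Fin n → Option (ZMod p)} (h : HasAltSeq X m) : m ≤ altVec X :=
  le_csSup (hasAlt_bdd X) h

lemma altVec_le {n p : ℕ} (X : Fin n → Option (ZMod p)) : altVec X ≤ n :=
  hasAlt_le (hasAlt_altVec X)

lemma hasAlt_mono {n p m : ℕ} {X Y : Fin n → Option (ZMod p)} (hXY : sle X Y)
    (h : HasAltSeq X m) : HasAltSeq Y m := by
  obtain ⟨s, h1, h2, h3⟩ := h
  refine ⟨s, h1, fun j => ?_, fun j h => ?_⟩
  · rw [hXY _ (h2 j)]; exact h2 j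
  · rw [hXY _ (h2 _), hXY _ (h2 _)]; exact h3 j h

lemma hasAlt_act {n p m : ℕ} (a : ZMod p) {X : Fin n → Option (ZMod p)}
    (h : HasAltSeq X m) : HasAltSeq (sact a X) m := by
  obtain ⟨s, h1, h2, h3⟩ := h
  refine ⟨s, h1, fun j => (sact_ne _ _ _).2 (h2 j), fun j h he => h3 j h ?_⟩
  exact Option.map_injective (add_right_injective a) he

lemma sact_neg {n p : ℕ} (a : ZMod p) (X : Fin n → Option (ZMod p)) :
    sact (-a) (sact a X) = X := by
  funext i
  simp only [sact, Option.map_map]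
  have : ((fun x => -a + x) ∘ fun x => a + x) = id := by funext x; simp
  rw [this, Option.map_id, id]

lemma altVec_act {n p : ℕ} (a : ZMod p) (X : Fin n → Option (ZMod p)) :
    altVec (sact a X) = altVec X := by
  apply le_antisymm
  · have := hasAlt_act (-a) (hasAlt_altVec (sact a X))
    rw [sact_neg] at this
    exact le_altVec this
  · exact le_altVec (hasAlt_act a (hasAlt_altVec X))

/-- prepend -/
lemma hasAlt_cons {n p m : ℕ} {Y : Fin n → Option (ZMod p)} (s : Fin m → Fin n)
    (h1 : StrictMono s) (h2 : ∀ j, Y (s j) ≠ none)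
    (h3 : ∀ (j : ℕ) (h : j + 1 < m), Y (s ⟨j, by omega⟩) ≠ Y (s ⟨j + 1, h⟩))
    (i : Fin n) (hi : Y i ≠ none)
    (h0 : ∀ h : 0 < m, i < s ⟨0, h⟩ ∧ Y i ≠ Y (s ⟨0, h⟩)) : HasAltSeq Y (m + 1) := by
  refine ⟨Fin.cons i s, ?_, ?_, ?_⟩
  · intro a b hab
    induction a using Fin.cases with
    | zero =>
      induction b using Fin.cases with
      | zero => simp at hab
      | succ b =>
        simp only [Fin.cons_zero, Fin.cons_succ]
        have hm : 0 < m := by have := b.2; omega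
        exact (h0 hm).1.trans_le (h1.monotone (by simp [Fin.le_def]))
    | succ a =>
      induction b using Fin.cases with
      | zero => simp at hab
      | succ b =>
        simp only [Fin.cons_succ]
        exact h1 (by simpa using hab)
  · intro j
    induction j using Fin.cases with
    | zero => simpa using hi
    | succ j => simpa using h2 j
  · intro j h
    cases j with
    | zero =>
      have := (h0 (by omega)).2
      exact this
    | succ j => exact h3 j (by omega)

lemma exists_first {n p : ℕ} (X : Fin n → Option (ZMod p)) (h : ∃ i, X i ≠ none) :
    ∃ a : ZMod p, ∃ i, X i = some a ∧ ∀ k < i, X k = none := by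
  classical
  let S := Finset.univ.filter fun i => X i ≠ none
  have hS : S.Nonempty := by obtain ⟨i, hi⟩ := h; exact ⟨i, by simp [S, hi]⟩
  have h1 := S.min'_mem hS
  have h2 : X (S.min' hS) ≠ none := by simpa [S] using h1
  obtain ⟨a, ha⟩ := Option.ne_none_iff_exists'.1 h2
  refine ⟨a, _, ha, fun k hk => ?_⟩
  by_contra hne
  exact absurd (S.min'_le k (by simp [S, hne])) (not_le.2 hk)

open Classical in
noncomputable def first {n p : ℕ} (X : Fin n → Option (ZMod p)) : ZMod p :=
  if h : ∃ i, X i ≠ none then (exists_first X h).choose else 0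

lemma first_spec {n p : ℕ} (X : Fin n → Option (ZMod p)) (h : ∃ i, X i ≠ none) :
    ∃ i, X i = some (first X) ∧ ∀ k < i, X k = none := by
  rw [first, dif_pos h]
  exact (exists_first X h).choose_spec

lemma first_uniq {n p : ℕ} {X : Fin n → Option (ZMod p)} {a b : ZMod p}
    (ha : ∃ i, X i = some a ∧ ∀ k < i, X k = none)
    (hb : ∃ i, X i = some b ∧ ∀ k < i, X k = none) : a = b := by
  obtain ⟨i, h1, h2⟩ := ha
  obtain ⟨j, h3, h4⟩ := hb
  rcases lt_trichotomy i j with h | rfl | h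
  · rw [h4 i h] at h1; cases h1
  · rw [h1] at h3; exact Option.some.inj h3
  · rw [h2 j h] at h3; cases h3

lemma first_act {n p : ℕ} (a : ZMod p) (X : Fin n → Option (ZMod p)) (h : ∃ i, X i ≠ none) :
    first (sact a X) = a + first X := by
  have h' : ∃ i, sact a X i ≠ none := by
    obtain ⟨i, hi⟩ := h; exact ⟨i, (sact_ne _ _ _).2 hi⟩
  apply first_uniq (first_spec _ h')
  obtain ⟨i, h1, h2⟩ := first_spec X h
  exact ⟨i, by simp [sact, h1], fun k hk => by simp [sact, h2 k hk]⟩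

lemma altVec_pos {n p : ℕ} (X : Fin n → Option (ZMod p)) (h : ∃ i, X i ≠ none) :
    1 ≤ altVec X := by
  obtain ⟨i, hi⟩ := h
  exact le_altVec (hasAlt_cons (fun i : Fin 0 => i.elim0) (fun i => i.elim0) (fun i => i.elim0)
    (fun j h => by omega) i hi (fun h => by omega))

lemma alt_mono {n p : ℕ} {X Y : Fin n → Option (ZMod p)} (hX : ∃ i, X i ≠ none)
    (hY : ∃ i, Y i ≠ none) (hXY : sle X Y) : altVec X < altVec Y ∨ first X = first Y := by
  by_cases hf : first X = first Y
  · exact Or.inr hf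
  left
  have hpos := altVec_pos X hX
  obtain ⟨i, hi1, hi2⟩ := first_spec X hX
  obtain ⟨k, hk1, hk2⟩ := first_spec Y hY
  obtain ⟨s, h1, h2, h3⟩ := hasAlt_altVec X
  have h2' : ∀ j, Y (s j) ≠ none := fun j => by rw [hXY _ (h2 j)]; exact h2 j
  have h3' : ∀ (j : ℕ) (h : j + 1 < altVec X), Y (s ⟨j, by omega⟩) ≠ Y (s ⟨j + 1, h⟩) := by
    intro j h
    rw [hXY _ (h2 _), hXY _ (h2 _)]; exact h3 j h
  have his : i ≤ s ⟨0, hpos⟩ := by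
    by_contra hlt
    exact h2 _ (hi2 _ (not_le.1 hlt))
  have hYi : Y i = some (first X) := by rw [hXY i (by simp [hi1]), hi1]
  have hki : k < i := by
    rcases lt_trichotomy k i with h | rfl | h
    · exact h
    · rw [hk1] at hYi; exact absurd (Option.some.inj hYi).symm hf
    · rw [hk2 i h] at hYi; cases hYi
  have : HasAltSeq Y (altVec X + 1) := by
    by_cases hc : Y (s ⟨0, hpos⟩) = some (first Y)
    · refine hasAlt_cons s h1 h2' h3' i (by simp [hYi]) fun _ => ⟨?_, ?_⟩
      · refine lt_of_le_of_ne his fun he => hf ?_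
        rw [← he, hYi] at hc
        exact Option.some.inj hc
      · rw [hYi, hc]
        exact fun h => hf (Option.some.inj h)
    · refine hasAlt_cons s h1 h2' h3' k (by simp [hk1]) fun _ => ⟨hki.trans_le his, ?_⟩
      rw [hk1]
      exact fun h => hc h.symm
  exact le_altVec this

/-! equivariant choice -/

lemma exists_equiv {p : ℕ} {A : Type*} (act : ZMod p → A → A) (h0 : ∀ x, act 0 x = x)
    (hact : ∀ a b x, act a (act b x) = act (a + b) x) :
    ∃ s : A → ZMod p, ∀ x, (∀ a, act a x = x → a = 0) → ∀ a, s (act a x) = a + s x := by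
  classical
  let R : Setoid A :=
    { r := fun x y => ∃ a, act a x = y
      iseqv := ⟨fun x => ⟨0, h0 x⟩,
        fun {x y} ⟨a, h⟩ => ⟨-a, by rw [← h, hact]; simp [h0]⟩,
        fun {x y z} ⟨a, h⟩ ⟨b, h'⟩ => ⟨b + a, by rw [← h', ← h, hact]⟩⟩ }
  have hex : ∀ x : A, ∃ a, act a (Quotient.out (s := R) (Quotient.mk R x)) = x := fun x =>
    Quotient.mk_out (s := R) x
  choose s hs using hex
  refine ⟨s, fun x hfree a => ?_⟩
  have hq : Quotient.mk R (act a x) = Quotient.mk R x := by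
    apply Quotient.sound
    exact ⟨-a, by rw [hact]; simp [h0]⟩
  have e1 := hs (act a x)
  have e2 := hs x
  rw [hq] at e1
  set q := Quotient.out (s := R) (Quotient.mk R x)
  have e3 : act (- s (act a x) + a + s x) q = q := by
    rw [add_assoc, ← hact, ← hact, e2]
    generalize s (act a x) = t at e1
    rw [← e1, hact, neg_add_cancel, h0]
  have e4 : act (- s (act a x) + a + s x) x = x := by
    generalize - s (act a x) + a + s x = t at e3
    rw [← e2, hact, add_comm, ← hact, e3]
  have := hfree _ e4
  linear_combination -this

/-! nonemptiness of the set defining the cross-index -/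

lemma xind_nonempty {W : Type*} [Fintype W] [DecidableEq W] (Eh : Set (Finset W)) (r p : ℕ)
    (hp : p.Prime) :
    {n | ∃ φ : (ZMod p → Finset W) → ZMod p × Fin (n + 1),
    (∀ x y, HomElem Eh r p x → HomElem Eh r p y → (∀ i, x i ⊆ y i) →
      ((φ x).2 < (φ y).2 ∨ φ x = φ y)) ∧
    (∀ (ε : ZMod p) (x), HomElem Eh r p x →
      φ (fun i => x (i + ε)) = (ε + (φ x).1, (φ x).2))}.Nonempty := by
  have : NeZero p := ⟨hp.ne_zero⟩
  obtain ⟨s, hs⟩ := exists_equiv (A := ZMod p → Finset W) (fun a x i => x (i + a))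
    (fun x => by simp) (fun a b x => by funext i; simp only; rw [add_assoc])
  have hb : ∀ x : ZMod p → Finset W, ∑ i, (x i).card ≤ p * Fintype.card W := by
    intro x
    calc ∑ i, (x i).card ≤ ∑ i : ZMod p, Fintype.card W :=
          Finset.sum_le_sum fun i _ => Finset.card_le_univ _
      _ = _ := by simp [ZMod.card]
  refine ⟨p * Fintype.card W, fun x => (s x, ⟨∑ i, (x i).card, Nat.lt_succ_of_le (hb x)⟩), ?_, ?_⟩
  · intro x y _ _ hxy
    by_cases h : x = y
    · right; rw [h]
    · left
      obtain ⟨i, hi⟩ := Function.ne_iff.1 h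
      simp only [Fin.mk_lt_mk]
      exact Finset.sum_lt_sum (fun i _ => Finset.card_le_card (hxy i))
        ⟨i, Finset.mem_univ _, Finset.card_lt_card ((hxy i).ssubset_of_ne hi)⟩
  · intro ε x hx
    refine Prod.ext ?_ ?_
    · apply hs x
      intro a ha
      by_contra hne
      have h1 := hx.2.1 (0 + a) 0 (by simpa using hne)
      have h2 := congrFun ha 0
      change x (0 + a) = x 0 at h2
      rw [h2, disjoint_self] at h1
      exact (hx.1 0).ne_empty h1
    · apply Fin.ext
      exact Fintype.sum_equiv (Equiv.addRight ε) _ _ (fun u => rfl)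

end XK

/-- **Theorem 3(ii), via Propositions 2 and 3:** if `F` contains `p` pairwise disjoint
edges, then `Xind_{Z_p}(Hom(K^r_p, KG^r(F))) + p ≥ |V(F)| − alt_p(F)`. -/
theorem xind_hom_kneser_ge {V : Type*} [Fintype V] [DecidableEq V]
    (r p : ℕ) (hr : 2 ≤ r) (hp : p.Prime) (hrp : r ≤ p)
    (E : Set (Finset V)) (hne : ∀ e ∈ E, e.Nonempty)
    (hmatch : ∃ S : Finset (Finset V), S.card = p ∧ (S : Set (Finset V)) ⊆ E ∧
      ∀ e ∈ S, ∀ f ∈ S, e ≠ f → Disjoint e f) :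
    Fintype.card V - altHyp E p ≤ XindHom (KGEdges E r) r p + p := by
  classical
  have : NeZero p := ⟨hp.ne_zero⟩
  have : Fact p.Prime := ⟨hp⟩
  obtain ⟨σ, hσ⟩ : ∃ σ : Fin (Fintype.card V) ≃ V, altHyp E p = altSigma E p σ :=
    Nat.sInf_mem (s := {a | ∃ σ : Fin (Fintype.card V) ≃ V, a = altSigma E p σ})
      ⟨_, (Fintype.equivFin V).symm, rfl⟩
  have hXmem : XindHom (KGEdges E r) r p ∈ _ :=
    Nat.sInf_mem (XK.xind_nonempty (W := {e : Finset V // e ∈ E}) (KGEdges E r) r p hp)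
  obtain ⟨φ, hφ1, hφ2⟩ := hXmem
  rw [hσ]
  generalize XindHom (KGEdges E r) r p = m at φ hφ1 hφ2
  -- the set of signs carrying an edge
  let A : (Fin (Fintype.card V) → Option (ZMod p)) → Finset (ZMod p) := fun X =>
    Finset.univ.filter fun ε => ∃ e ∈ E, (e : Set V) ⊆ σ '' {i | X i = some ε}
  have hA : ∀ X ε, ε ∈ A X ↔ ∃ e ∈ E, (e : Set V) ⊆ σ '' {i | X i = some ε} := by
    intro X ε; simp [A]
  let U : (Fin (Fintype.card V) → Option (ZMod p)) → ZMod p → Finset {e : Finset V // e ∈ E} := fun X i =>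
    Finset.univ.filter fun e => (e.1 : Set V) ⊆ σ '' {k | X k = some (-i)}
  have hU : ∀ X i e, e ∈ U X i ↔ (e.1 : Set V) ⊆ σ '' {k | X k = some (-i)} := by
    intro X i e; simp [U]
  have hact : ∀ a ε (X : Fin (Fintype.card V) → Option (ZMod p)),
      {i | XK.sact a X i = some ε} = {i | X i = some (ε - a)} := by
    intro a ε X
    ext i
    simp only [XK.sact, Set.mem_ofPred_eq, Option.map_eq_some_iff]
    constructor
    · rintro ⟨b, hb, rfl⟩; simp [hb]
    · intro h; exact ⟨_, h, by ring⟩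
  have hAact : ∀ a X, A (XK.sact a X) = (A X).image (a + ·) := by
    intro a X
    ext ε
    rw [hA, hact, ← hA, Finset.mem_image]
    constructor
    · intro h; exact ⟨_, h, by ring⟩
    · rintro ⟨b, hb, rfl⟩; simpa using hb
  have hUact : ∀ a X, U (XK.sact a X) = fun i => U X (i + a) := by
    intro a X
    funext i
    ext e
    rw [hU, hU, hact]
    have : -i - a = -(i + a) := by ring
    rw [this]
  have hsub : ∀ X Y, XK.sle X Y → ∀ ε : ZMod p,
      σ '' {i : Fin (Fintype.card V) | X i = some ε} ⊆ σ '' {i : Fin (Fintype.card V) | Y i = some ε} := by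
    intro X Y h ε
    apply Set.image_mono
    intro i hi
    simp only [Set.mem_ofPred_eq] at hi ⊢
    rw [h i (by simp [hi]), hi]
  have hAmono : ∀ X Y, XK.sle X Y → A X ⊆ A Y := by
    intro X Y h ε hε
    rw [hA] at hε ⊢
    obtain ⟨e, he, hs⟩ := hε
    exact ⟨e, he, hs.trans (hsub X Y h ε)⟩
  have hdisj : ∀ (X : Fin (Fintype.card V) → Option (ZMod p)) (i j : ZMod p) (e f : Finset V), i ≠ j →
      (e : Set V) ⊆ σ '' {k : Fin (Fintype.card V) | X k = some (-i)} →
      (f : Set V) ⊆ σ '' {k : Fin (Fintype.card V) | X k = some (-j)} → Disjoint e f := by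
    intro X i j e f hij he hf
    rw [Finset.disjoint_left]
    intro v hv hv'
    obtain ⟨k, hk, rfl⟩ := he hv
    obtain ⟨k', hk', hkk⟩ := hf hv'
    obtain rfl := σ.injective hkk
    simp only [Set.mem_ofPred_eq] at hk hk'
    rw [hk] at hk'
    exact hij (neg_injective (Option.some.inj hk'))
  have hHom : ∀ X, A X = Finset.univ → HomElem (KGEdges E r) r p (U X) := by
    intro X hX
    refine ⟨fun i => ?_, fun i j hij => ?_, ?_⟩
    · have : -i ∈ A X := by rw [hX]; simp
      obtain ⟨e, he, hs⟩ := (hA _ _).1 this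
      exact ⟨⟨e, he⟩, (hU _ _ _).2 hs⟩
    · rw [Finset.disjoint_left]
      intro e he hf
      have := hdisj X i j e.1 e.1 hij ((hU _ _ _).1 he) ((hU _ _ _).1 hf)
      rw [disjoint_self] at this
      exact (hne e.1 e.2).ne_empty this
    · intro T hT h1 h2
      refine ⟨hT, fun e he f hf hef => ?_⟩
      obtain ⟨i, hi⟩ := h1 e he
      obtain ⟨j, hj⟩ := h1 f hf
      have hij : i ≠ j := by
        rintro rfl
        exact hef (Finset.card_le_one.1 (h2 i) e (by simp [he, hi]) f (by simp [hf, hj]))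
      exact hdisj X i j e.1 f.1 hij ((hU _ _ _).1 hi) ((hU _ _ _).1 hj)
  obtain ⟨s0, hs0⟩ := XK.exists_equiv (A := Finset (ZMod p)) (fun a S => S.image (a + ·))
    (fun S => by simp) (fun a b S => by
      simp only [Finset.image_image]
      congr 1
      funext x
      simp [add_assoc])
  have hs0' : ∀ S : Finset (ZMod p), S ≠ ∅ → S ≠ Finset.univ → ∀ a,
      s0 (S.image (a + ·)) = a + s0 S := by
    intro S hS1 hS2
    refine hs0 S fun a ha => ?_
    by_contra hane
    apply hS2
    obtain ⟨x, hx⟩ := Finset.nonempty_iff_ne_empty.2 hS1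
    have hk : ∀ k : ℕ, (k : ZMod p) * a + x ∈ S := by
      intro k
      induction k with
      | zero => simpa using hx
      | succ k ih =>
        rw [← ha, Finset.mem_image]
        exact ⟨_, ih, by push_cast; ring⟩
    ext y
    simp only [Finset.mem_univ, iff_true]
    have := hk ((y - x) / a).val
    rw [ZMod.natCast_zmod_val, div_mul_cancel₀ _ hane] at this
    simpa using this
  have halt : ∀ X, A X = ∅ → altVec X ≤ altSigma E p σ := by
    intro X hX
    refine le_csSup ⟨Fintype.card V, ?_⟩ ⟨X, rfl, fun ε e he hs => ?_⟩
    · rintro a ⟨Y, rfl, -⟩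
      exact XK.altVec_le Y
    · have : ε ∈ A X := (hA _ _).2 ⟨e, he, hs⟩
      rw [hX] at this
      simp at this
  generalize altSigma E p σ = al at halt
  have hun : (Finset.univ : Finset (ZMod p)) ≠ ∅ := Finset.univ_nonempty.ne_empty
  have hcard : ∀ S : Finset (ZMod p), S ≠ Finset.univ → S.card < p := by
    intro S hS
    have := Finset.card_lt_univ_of_notMem (s := S) (x := Classical.choose (by
      by_contra h; push Not at h; exact hS (Finset.eq_univ_of_forall h) : ∃ x, x ∉ S))
      (Classical.choose_spec (by
      by_contra h; push Not at h; exact hS (Finset.eq_univ_of_forall h) : ∃ x, x ∉ S))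
    rwa [ZMod.card] at this
  have hmain : Fintype.card V ≤ al + p + m := by
    refine XK.tucker hp.one_lt
      (fun X => if A X = ∅ then XK.first X else
        if A X = Finset.univ then (φ (U X)).1 else s0 (A X))
      (fun X => if A X = ∅ then altVec X else
        if A X = Finset.univ then al + p + (φ (U X)).2 else al + (A X).card) ?_ ?_ ?_
    · intro a X hX
      have e1 : A (XK.sact a X) = ∅ ↔ A X = ∅ := by rw [hAact, Finset.image_eq_empty]
      have e2 : A (XK.sact a X) = Finset.univ ↔ A X = Finset.univ := by
        rw [hAact, ← Finset.card_eq_iff_eq_univ, ← Finset.card_eq_iff_eq_univ,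
          Finset.card_image_of_injective _ (add_right_injective a)]
      simp only [e1, e2]
      split_ifs with h1 h2
      · exact XK.first_act a X hX
      · rw [hUact, hφ2 a _ (hHom X h2)]
      · rw [hAact]; exact hs0' _ h1 h2 a
    · intro X Y hX hY hXY
      have hsubA := hAmono X Y hXY
      have hYe : A Y = ∅ → A X = ∅ := fun h => Finset.subset_empty.1 (h ▸ hsubA)
      have hXu : A X = Finset.univ → A Y = Finset.univ := fun h =>
        Finset.univ_subset_iff.1 (h ▸ hsubA)
      by_cases h1 : A X = ∅
      · have := halt X h1
        by_cases h2 : A Y = ∅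
        · simp only [h1, h2, if_true]
          exact XK.alt_mono hX hY hXY
        · left
          have := Finset.card_pos.2 (Finset.nonempty_iff_ne_empty.2 h2)
          have := hp.pos
          simp only [h1, h2, if_true, if_false]
          split_ifs <;> omega
      · have h2 : A Y ≠ ∅ := fun h => h1 (hYe h)
        by_cases h3 : A X = Finset.univ
        · have h4 := hXu h3
          simp only [h3, h4, hun, if_true, if_false]
          have := hφ1 (U X) (U Y) (hHom X h3) (hHom Y h4) (fun i e he => by
            rw [hU] at he ⊢; exact he.trans (hsub X Y hXY _))
          rcases this with h | h
          · left
            have : ((φ (U X)).2 : ℕ) < (φ (U Y)).2 := h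
            omega
          · right; rw [h]
        · have hc := hcard _ h3
          by_cases h4 : A Y = Finset.univ
          · left
            simp only [h1, h3, h4, hun, if_true, if_false]
            omega
          · simp only [h1, h2, h3, h4, if_false]
            by_cases h5 : A X = A Y
            · right; rw [h5]
            · left
              have := Finset.card_lt_card (hsubA.ssubset_of_ne h5)
              omega
    · intro X hX
      have hpp := hp.pos
      split_ifs with h1 h2
      · have := XK.altVec_pos X hX
        have := halt X h1
        omega
      · have := (φ (U X)).2.2
        omega
      · have := Finset.card_pos.2 (Finset.nonempty_iff_ne_empty.2 h1)
        have := hcard _ h2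
        omega
  omega
end

section
/- Let H be an r-uniform hypergraph (r ≥ 2) with at least one edge, and let p be a prime with r ≤ p ≤ ω(H). Set t = Xind_{Z_p}(Hom(K^r_p, H)) + p, and write t = ap + b with a, b nonnegative integers and 0 ≤ b ≤ p − 1. Then the local chromatic number of H satisfies χ_l(H) ≥ min( ⌈((p − r + 1)·a + min{p − r + 1, b}) / (r − 1)⌉ + 1, ⌈t / (r − 1)⌉ ). -/
/-- The closed neighborhood `N[X] = X ∪ N(X)` of a vertex set `X` in a hypergraph,
where `N(X) = {v : ∃ e ∈ E(H), e ∖ X = {v}}`. -/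
def closedNbr {W : Type*} [DecidableEq W] (Eh : Set (Finset W)) (X : Finset W) : Set W :=
  ↑X ∪ {v | ∃ e ∈ Eh, e \ X = {v}}

open Finset in
theorem aux_trans {W : Type*} [DecidableEq W] {Eh : Set (Finset W)} {r p : ℕ}
    {U : ZMod p → Finset W} (hU : HomElem Eh r p U) (J : Finset (ZMod p)) (x : ZMod p → W)
    (hx : ∀ i ∈ J, x i ∈ U i) : (J.image x).card = J.card ∧ (J.card = r → J.image x ∈ Eh) := by
  have huniq : ∀ i j v, v ∈ U i → v ∈ U j → i = j := by
    intro i j v h1 h2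
    by_contra h
    exact (Finset.disjoint_left.mp (hU.2.1 i j h)) h1 h2
  have hcard : (J.image x).card = J.card := by
    apply Finset.card_image_of_injOn
    intro i hi j hj hij
    exact huniq i j (x i) (hx i hi) (by rw [hij]; exact hx j hj)
  refine ⟨hcard, fun hJ => hU.2.2 _ (hcard.trans hJ) ?_ ?_⟩
  · intro v hv
    obtain ⟨i, hi, rfl⟩ := Finset.mem_image.mp hv
    exact ⟨i, hx i hi⟩
  · intro i
    rw [Finset.card_le_one]
    intro u hu v hv
    rw [Finset.mem_inter, Finset.mem_image] at hu hv
    obtain ⟨⟨j, hj, rfl⟩, hu⟩ := hu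
    obtain ⟨⟨k, hk, rfl⟩, hv⟩ := hv
    rw [huniq j i _ (hx j hj) hu, huniq k i _ (hx k hk) hv]

theorem aux_color {W : Type*} [DecidableEq W] {Eh : Set (Finset W)} {r p : ℕ} [NeZero p]
    {Ct : Type*} [DecidableEq Ct] {c : W → Ct}
    (hc : ∀ e ∈ Eh, ∃ u ∈ e, ∃ v ∈ e, c u ≠ c v)
    {U : ZMod p → Finset W} (hU : HomElem Eh r p U) (γ : Ct) :
    (Finset.univ.filter (fun i => γ ∈ (U i).image c)).card < r := by
  by_contra h
  push Not at h
  obtain ⟨J, hJs, hJ⟩ := Finset.exists_subset_card_eq h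
  have h1 : ∀ i, ∃ w, i ∈ J → w ∈ U i ∧ c w = γ := by
    intro i
    by_cases hi : i ∈ J
    · have := hJs hi
      rw [Finset.mem_filter, Finset.mem_image] at this
      obtain ⟨_, w, hw, hw2⟩ := this
      exact ⟨w, fun _ => ⟨hw, hw2⟩⟩
    · obtain ⟨w, _⟩ := hU.1 i
      exact ⟨w, fun h => absurd h hi⟩
  choose x hx using h1
  obtain ⟨u, hu, v, hv, huv⟩ := hc _ ((aux_trans hU J x (fun i hi => (hx i hi).1)).2 hJ)
  obtain ⟨i, hi, rfl⟩ := Finset.mem_image.mp hu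
  obtain ⟨j, hj, rfl⟩ := Finset.mem_image.mp hv
  exact huv ((hx i hi).2.trans (hx j hj).2.symm)

theorem aux_count {W : Type*} [DecidableEq W] {Eh : Set (Finset W)} {r p : ℕ} [NeZero p]
    {Ct : Type*} [DecidableEq Ct] {c : W → Ct}
    (hc : ∀ e ∈ Eh, ∃ u ∈ e, ∃ v ∈ e, c u ≠ c v)
    {U : ZMod p → Finset W} (hU : HomElem Eh r p U) (I : Finset (ZMod p)) :
    ∑ i ∈ I, ((U i).image c).card ≤ (r - 1) * (I.biUnion (fun i => (U i).image c)).card := by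
  have h1 := Finset.sum_card_bipartiteAbove_eq_sum_card_bipartiteBelow
    (s := I) (t := I.biUnion (fun i => (U i).image c)) (fun i γ => γ ∈ (U i).image c)
  have h2 : ∑ i ∈ I, ((U i).image c).card = ∑ i ∈ I,
      (Finset.bipartiteAbove (fun i γ => γ ∈ (U i).image c)
        (I.biUnion (fun i => (U i).image c)) i).card := by
    apply Finset.sum_congr rfl
    intro i hi
    congr 1
    ext γ
    rw [Finset.mem_bipartiteAbove]
    exact ⟨fun h => ⟨Finset.mem_biUnion.mpr ⟨i, hi, h⟩, h⟩, fun h => h.2⟩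
  rw [h2, h1, mul_comm, ← smul_eq_mul]
  apply Finset.sum_le_card_nsmul
  intro γ _
  have h3 := aux_color hc hU γ
  have h4 : (Finset.bipartiteBelow (fun i γ => γ ∈ (U i).image c) I γ).card
      ≤ (Finset.univ.filter (fun i => γ ∈ (U i).image c)).card := by
    apply Finset.card_le_card
    intro i hi
    rw [Finset.mem_bipartiteBelow] at hi
    simpa using hi.2
  omega

theorem aux_sign (p : ℕ) (hp : p.Prime) (α : Type*) :
    ∃ s : (ZMod p → α) → ZMod p, ∀ f : ZMod p → α, (∃ i j, f i ≠ f j) →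
      ∀ ε, s (fun i => f (i + ε)) = ε + s f := by
  classical
  haveI : Fact p.Prime := ⟨hp⟩
  let S : Setoid (ZMod p → α) :=
    { r := fun f g => ∃ ε, g = fun i => f (i + ε)
      iseqv := by
        refine ⟨fun f => ⟨0, by simp⟩, ?_, ?_⟩
        · rintro f g ⟨ε, rfl⟩
          exact ⟨-ε, by funext i; simp⟩
        · rintro f g h ⟨ε, rfl⟩ ⟨δ, rfl⟩
          exact ⟨δ + ε, by funext i; simp [add_assoc]⟩ }
  have hrep : ∀ f : ZMod p → α, ∃ ε, f = fun i => (Quotient.out (Quotient.mk S f)) (i + ε) :=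
    fun f => Quotient.mk_out (s := S) f
  choose s hs using hrep
  refine ⟨s, ?_⟩
  rintro f ⟨i, j, hij⟩ ε
  set g : ZMod p → α := fun i => f (i + ε) with hg
  have hfg : Quotient.mk S g = Quotient.mk S f :=
    Quotient.sound (S.symm ⟨ε, rfl⟩)
  have h1 := hs g
  rw [hfg] at h1
  have h2 := hs f
  set R := Quotient.out (Quotient.mk S f)
  by_contra hne
  have hδ : s g - (ε + s f) ≠ 0 := sub_ne_zero.mpr hne
  set δ := s g - (ε + s f) with hδd
  have hper : ∀ k, R (k + δ) = R k := by
    intro k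
    have e1 := congrFun h1 (k - ε - s f)
    have e2 := congrFun h2 (k - s f)
    simp only [hg] at e1
    rw [show k - ε - s f + ε = k - s f by ring, e2] at e1
    rw [show k - s f + s f = k by ring, show k - ε - s f + s g = k + δ by rw [hδd]; ring] at e1
    exact e1.symm
  have hpern : ∀ n : ℕ, ∀ k, R (k + n * δ) = R k := by
    intro n
    induction n with
    | zero => simp
    | succ n ih =>
      intro k
      rw [show k + ((n + 1 : ℕ) : ZMod p) * δ = (k + n * δ) + δ by push_cast; ring, hper, ih]
  have hconst : ∀ k, R k = R 0 := by
    intro k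
    have := hpern (k / δ).val 0
    rw [ZMod.natCast_zmod_val, div_mul_cancel₀ _ hδ, zero_add] at this
    exact this
  apply hij
  rw [congrFun h2 i, congrFun h2 j]
  rw [hconst, hconst (j + _)]

theorem aux_main {W : Type*} [Fintype W] [DecidableEq W]
    (r p : ℕ) (hp : p.Prime) (hrp : r ≤ p)
    (Eh : Set (Finset W))
    (hclique : ∃ S : Finset W, S.card = p ∧ ∀ T ⊆ S, T.card = r → T ∈ Eh)
    (a b : ℕ) (hb : b ≤ p - 1) (hab : XindHom Eh r p + p = a * p + b)
    (Ct : Type*) [DecidableEq Ct] (c : W → Ct)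
    (hc : ∀ e ∈ Eh, ∃ u ∈ e, ∃ v ∈ e, c u ≠ c v) :
    ∃ U : ZMod p → Finset W, HomElem Eh r p U ∧ (∀ i, a ≤ ((U i).image c).card) ∧
      ∃ B : Finset (ZMod p), B.card = b ∧ ∀ i ∈ B, a + 1 ≤ ((U i).image c).card := by
  haveI : Fact p.Prime := ⟨hp⟩
  have hp0 : 0 < p := hp.pos
  let n : (ZMod p → Finset W) → ZMod p → ℕ := fun U i => ((U i).image c).card
  let m : (ZMod p → Finset W) → ℕ := fun U => ⨅ i, n U i
  have hm : ∀ U i, m U ≤ n U i := fun U i => ciInf_le (OrderBot.bddBelow _) i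
  have hm' : ∀ U, ∃ i, n U i = m U := fun U => by
    have := Nat.sInf_mem (Set.range_nonempty (n U))
    obtain ⟨i, hi⟩ := this
    exact ⟨i, hi⟩
  let B : (ZMod p → Finset W) → Finset (ZMod p) := fun U => Finset.univ.filter (fun i => m U < n U i)
  have hBlt : ∀ U, (B U).card < p := by
    intro U
    obtain ⟨i, hi⟩ := hm' U
    have : B U ⊂ Finset.univ := by
      rw [Finset.ssubset_univ_iff]
      intro h
      have : i ∈ B U := by rw [h]; simp
      simp [B, hi] at this
    have := Finset.card_lt_card this
    rwa [Finset.card_univ, ZMod.card] at this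
  let l : (ZMod p → Finset W) → ℕ := fun U => p * m U + (B U).card
  have hmpos : ∀ U, HomElem Eh r p U → 1 ≤ m U := by
    intro U hU
    obtain ⟨i, hi⟩ := hm' U
    rw [← hi]
    exact Finset.card_pos.mpr ((hU.1 i).image c)
  have hlp : ∀ U, HomElem Eh r p U → p ≤ l U := by
    intro U hU
    have := Nat.mul_le_mul_left p (hmpos U hU)
    simp only [l]
    omega
  -- key: some element has large value
  have key : ∃ U, HomElem Eh r p U ∧ a * p + b ≤ l U := by
    rcases Nat.eq_zero_or_pos (XindHom Eh r p) with h0 | hpos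
    · obtain ⟨S, hS, hST⟩ := hclique
      have hcard : Fintype.card (ZMod p) = Fintype.card S := by simp [ZMod.card, hS]
      let x := Fintype.equivOfCardEq hcard
      have hU : HomElem Eh r p (fun i => {(x i : W)}) := by
        refine ⟨fun i => by simp, ?_, ?_⟩
        · intro i j hij
          rw [Finset.disjoint_singleton]
          intro h
          exact hij (x.injective (Subtype.ext h))
        · intro T hT hTm _
          refine hST T ?_ hT
          intro v hv
          obtain ⟨i, hi⟩ := hTm v hv
          rw [Finset.mem_singleton] at hi
          rw [hi]
          exact (x i).2
      refine ⟨_, hU, ?_⟩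
      have := hlp _ hU
      omega
    · by_contra hno
      push Not at hno
      have hmem : XindHom Eh r p - 1 ∈ {n | ∃ φ : (ZMod p → Finset W) → ZMod p × Fin (n + 1),
          (∀ x y, HomElem Eh r p x → HomElem Eh r p y → (∀ i, x i ⊆ y i) →
            ((φ x).2 < (φ y).2 ∨ φ x = φ y)) ∧
          (∀ (ε : ZMod p) (x), HomElem Eh r p x →
            φ (fun i => x (i + ε)) = (ε + (φ x).1, (φ x).2))} := by
        obtain ⟨s, hs⟩ := aux_sign p hp (Prop × Finset Ct)
        let K : (ZMod p → Finset W) → ZMod p → Prop × Finset Ct := fun U i =>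
          (i ∈ B U, if B U = ∅ then (U i).image c else ∅)
        have hKne : ∀ U, HomElem Eh r p U → ∃ i j, K U i ≠ K U j := by
          intro U hU
          by_contra hcon
          push Not at hcon
          obtain ⟨i, hi⟩ := hm' U
          have hiB : i ∉ B U := by simp [B, hi]
          have hB : B U = ∅ := by
            rw [Finset.eq_empty_iff_forall_notMem]
            intro j hj
            have := congrArg Prod.fst (hcon i j)
            simp only [K, eq_iff_iff] at this
            exact hiB (this.mpr hj)
          have hall : ∀ j, (U i).image c = (U j).image c := by
            intro j
            have := congrArg Prod.snd (hcon i j)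
            simpa only [K, hB, if_true] using this
          obtain ⟨γ, hγ⟩ := (hU.1 i).image c
          have := aux_color hc hU γ
          rw [Finset.filter_true_of_mem (fun j _ => by rw [← hall j]; exact hγ),
            Finset.card_univ, ZMod.card] at this
          omega
        have hlt : ∀ U, min (l U - p) (XindHom Eh r p - 1) < XindHom Eh r p - 1 + 1 := by
          intro U
          omega
        have hval : ∀ U, HomElem Eh r p U →
            min (l U - p) (XindHom Eh r p - 1) = l U - p := by
          intro U hU
          have := hno U hU
          omega
        refine ⟨fun U => (s (K U), ⟨min (l U - p) (XindHom Eh r p - 1), hlt U⟩), ?_, ?_⟩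
        · intro x y hx hy hxy
          have hsub : ∀ i, (x i).image c ⊆ (y i).image c := fun i =>
            Finset.image_subset_image (hxy i)
          have hn : ∀ i, n x i ≤ n y i := fun i => Finset.card_le_card (hsub i)
          have hmm : m x ≤ m y := by
            obtain ⟨i, hi⟩ := hm' y
            rw [← hi]
            exact (hm x i).trans (hn i)
          have hBsub : m x = m y → B x ⊆ B y := by
            intro h i hi
            simp only [B, Finset.mem_filter, Finset.mem_univ, true_and] at hi ⊢
            have := hn i
            omega
          have hl : l x < l y ∨ (m x = m y ∧ B x = B y) := by
            rcases hmm.lt_or_eq with h | h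
            · left
              have h1 := hBlt x
              have h2 := Nat.mul_le_mul_left p (Nat.succ_le_of_lt h)
              rw [Nat.mul_succ] at h2
              simp only [l]
              omega
            · rcases (Finset.card_le_card (hBsub h)).lt_or_eq with h' | h'
              · left
                simp only [l]
                rw [h]
                omega
              · right
                exact ⟨h, Finset.eq_of_subset_of_card_le (hBsub h) h'.ge⟩
          rcases hl with hl | ⟨h1, h2⟩
          · left
            simp only [Fin.mk_lt_mk, hval x hx, hval y hy]
            have := hlp x hx
            omega
          · right
            have hll : l x = l y := by simp only [l, h1, h2]
            have hK : K x = K y := by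
              funext i
              simp only [K, h2]
              congr 1
              split_ifs with hB
              · apply Finset.eq_of_subset_of_card_le (hsub i)
                have hi : i ∉ B y := by rw [hB]; simp
                simp only [B, Finset.mem_filter, Finset.mem_univ, true_and, not_lt] at hi
                have := hm x i
                change n y i ≤ n x i
                omega
              · rfl
            simp only [hK, hll]
        · intro ε x hx
          have hmε : m (fun i => x (i + ε)) = m x :=
            (Equiv.addRight ε).iInf_congr (fun i => rfl)
          have hBε : ∀ i, i ∈ B (fun i => x (i + ε)) ↔ i + ε ∈ B x := by
            intro i
            simp only [B, Finset.mem_filter, Finset.mem_univ, true_and, hmε]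
            rfl
          have hBc : (B (fun i => x (i + ε))).card = (B x).card := by
            apply Finset.card_equiv (Equiv.addRight ε)
            intro i
            exact hBε i
          have hle : l (fun i => x (i + ε)) = l x := by simp only [l, hmε, hBc]
          have hBe : B (fun i => x (i + ε)) = ∅ ↔ B x = ∅ := by
            rw [← Finset.card_eq_zero, hBc, Finset.card_eq_zero]
          have hK : K (fun i => x (i + ε)) = fun i => K x (i + ε) := by
            funext i
            simp only [K, hBε, hBe]
          simp only [hK, hle, hs (K x) (hKne x hx) ε]
      have := Nat.sInf_le hmem
      change XindHom Eh r p ≤ _ at this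
      omega
  obtain ⟨U, hU, hl⟩ := key
  have hBl := hBlt U
  have hma : a ≤ m U := by
    by_contra h
    push Not at h
    have h2 := Nat.mul_le_mul_left p (Nat.succ_le_of_lt h)
    rw [Nat.mul_succ, mul_comm p a] at h2
    simp only [l] at hl
    omega
  refine ⟨U, hU, fun i => hma.trans (hm U i), ?_⟩
  have hBig : b ≤ (Finset.univ.filter (fun i => a + 1 ≤ n U i)).card := by
    rcases hma.lt_or_eq with h | h
    · rw [Finset.filter_true_of_mem (fun i _ => (Nat.succ_le_of_lt h).trans (hm U i)),
        Finset.card_univ, ZMod.card]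
      omega
    · have : (Finset.univ.filter (fun i => a + 1 ≤ n U i)) = B U := by
        simp only [B, ← h, Nat.succ_le_iff]
      rw [this]
      simp only [l, ← h] at hl
      rw [mul_comm p a] at hl
      omega
  obtain ⟨B', hB', hB'c⟩ := Finset.exists_subset_card_eq hBig
  exact ⟨B', hB'c, fun i hi => (Finset.mem_filter.mp (hB' hi)).2⟩

theorem aux_ceil (x r k : ℕ) (hr : 2 ≤ r) (h : x ≤ (r - 1) * k) :
    (x + r - 2) / (r - 1) ≤ k := by
  have : (x + r - 2) / (r - 1) < k + 1 := by
    rw [Nat.div_lt_iff_lt_mul (by omega), mul_comm, Nat.mul_succ]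
    omega
  omega

theorem aux_sum {ι : Type*} [DecidableEq ι] (I B : Finset ι) (n : ι → ℕ) (a : ℕ)
    (h : ∀ i, a ≤ n i) (hB : ∀ i ∈ B, a + 1 ≤ n i) :
    I.card * a + (I ∩ B).card ≤ ∑ i ∈ I, n i := by
  have : I.card * a + (I ∩ B).card = ∑ i ∈ I, (a + if i ∈ B then 1 else 0) := by
    rw [Finset.sum_add_distrib, Finset.sum_const, smul_eq_mul, Finset.sum_boole,
      Finset.filter_mem_eq_inter]
    simp
  rw [this]
  apply Finset.sum_le_sum
  intro i _
  split_ifs with hi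
  · exact hB i hi
  · simpa using h i

/-- **Theorem 4:** lower bound for the local chromatic number of an `r`-uniform
hypergraph `H` with at least one edge and `r ≤ p ≤ ω(H)`, where
`t = Xind_{Z_p}(Hom(K^r_p, H)) + p = a·p + b`:
every proper coloring has a pair `(e, v)` whose closed neighborhood `N[e ∖ {v}]`
receives at least `min(⌈((p−r+1)a + min(p−r+1, b))/(r−1)⌉ + 1, ⌈t/(r−1)⌉)` colors
(ceilings `⌈x/(r−1)⌉` are written `(x + r - 2)/(r - 1)` in ℕ). -/
theorem local_chromatic_hypergraph {W : Type*} [Fintype W] [DecidableEq W]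
    (r p : ℕ) (hr : 2 ≤ r) (hp : p.Prime) (hrp : r ≤ p)
    (Eh : Set (Finset W)) (hEh : Eh.Nonempty) (hunif : ∀ e ∈ Eh, e.card = r)
    (hclique : ∃ S : Finset W, S.card = p ∧ ∀ T ⊆ S, T.card = r → T ∈ Eh)
    (a b : ℕ) (hb : b ≤ p - 1) (hab : XindHom Eh r p + p = a * p + b)
    (Ct : Type*) (c : W → Ct)
    (hc : ∀ e ∈ Eh, ∃ u ∈ e, ∃ v ∈ e, c u ≠ c v) :
    ∃ e ∈ Eh, ∃ v ∈ e,
      min ((((p - r + 1) * a + min (p - r + 1) b) + r - 2) / (r - 1) + 1)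
          ((XindHom Eh r p + p + r - 2) / (r - 1))
        ≤ (c '' closedNbr Eh (e.erase v)).ncard := by
  classical
  haveI : Fact p.Prime := ⟨hp⟩
  obtain ⟨U, hU, hUa, B, hBc, hB⟩ := aux_main r p hp hrp Eh hclique a b hb hab Ct c hc
  -- choice of the large parts
  have hI : ∃ I : Finset (ZMod p), I.card = p - r + 1 ∧ min (p - r + 1) b ≤ (I ∩ B).card := by
    rcases le_total (p - r + 1) b with h | h
    · obtain ⟨I, hIB, hIc⟩ := Finset.exists_subset_card_eq (h.trans hBc.ge)
      exact ⟨I, hIc, by rw [Finset.inter_eq_left.mpr hIB, hIc]; exact min_le_left _ _⟩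
    · obtain ⟨I, hBI, _, hIc⟩ := Finset.exists_subsuperset_card_eq (Finset.subset_univ B)
        (hBc.le.trans h) (by rw [Finset.card_univ, ZMod.card]; omega)
      exact ⟨I, hIc, by rw [Finset.inter_eq_right.mpr hBI, hBc]; exact min_le_right _ _⟩
  obtain ⟨I, hIc, hIB⟩ := hI
  have hcompl : Iᶜ.card = r - 1 := by
    rw [Finset.card_compl, ZMod.card, hIc]; omega
  let CI := I.biUnion (fun i => (U i).image c)
  have hCI : ((p - r + 1) * a + min (p - r + 1) b + r - 2) / (r - 1) ≤ CI.card := by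
    apply aux_ceil _ _ _ hr
    refine le_trans ?_ (aux_count hc hU I)
    refine le_trans ?_ (aux_sum I B _ a hUa hB)
    rw [hIc]
    omega
  -- neighborhoods of transversals
  have hnb : ∀ x : ZMod p → W, (∀ i, x i ∈ U i) → ∃ e ∈ Eh, ∃ v ∈ e,
      (∀ j, j ∉ I → c (x j) ∈ c '' closedNbr Eh (e.erase v)) ∧
      (∀ γ ∈ CI, γ ∈ c '' closedNbr Eh (e.erase v)) := by
    intro x hx
    have hnotin : ∀ i ∈ I, ∀ w ∈ U i, w ∉ Iᶜ.image x := by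
      intro i hi w hw hwm
      obtain ⟨j, hj, rfl⟩ := Finset.mem_image.mp hwm
      have hne : i ≠ j := by
        rintro rfl
        exact (Finset.mem_compl.mp hj) hi
      exact Finset.disjoint_left.mp (hU.2.1 i j hne) hw (hx j)
    have hedge : ∀ i ∈ I, ∀ w ∈ U i, insert w (Iᶜ.image x) ∈ Eh := by
      intro i hi w hw
      have hic : i ∉ Iᶜ := by simpa using hi
      have := (aux_trans hU (insert i Iᶜ) (Function.update x i w) (by
        intro j _
        by_cases hji : j = i
        · subst hji; simpa using hw
        · rw [Function.update_of_ne hji]; exact hx j)).2 (by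
        rw [Finset.card_insert_of_notMem hic, hcompl]; omega)
      rw [Finset.image_insert, Function.update_self] at this
      have h2 : Iᶜ.image (Function.update x i w) = Iᶜ.image x := by
        apply Finset.image_congr
        intro j hj
        apply Function.update_of_ne
        rintro rfl
        exact hic (by simpa using hj)
      rwa [h2] at this
    obtain ⟨i₀, hi₀⟩ : I.Nonempty := by rw [← Finset.card_pos]; omega
    refine ⟨_, hedge i₀ hi₀ _ (hx i₀), x i₀, Finset.mem_insert_self _ _, ?_, ?_⟩
    · intro j hj
      rw [Finset.erase_insert (hnotin i₀ hi₀ _ (hx i₀))]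
      refine ⟨x j, Or.inl ?_, rfl⟩
      exact Finset.mem_coe.mpr (Finset.mem_image_of_mem x (Finset.mem_compl.mpr hj))
    · intro γ hγ
      rw [Finset.erase_insert (hnotin i₀ hi₀ _ (hx i₀))]
      obtain ⟨i, hi, hγ⟩ := Finset.mem_biUnion.mp hγ
      obtain ⟨w, hw, rfl⟩ := Finset.mem_image.mp hγ
      refine ⟨w, Or.inr ⟨_, hedge i hi w hw, ?_⟩, rfl⟩
      rw [Finset.insert_sdiff_of_notMem _ (hnotin i hi w hw), Finset.sdiff_self]
      rfl
  have hcard : ∀ (D : Finset Ct) (X : Finset W), (∀ γ ∈ D, γ ∈ c '' closedNbr Eh X) →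
      D.card ≤ (c '' closedNbr Eh X).ncard := by
    intro D X h
    rw [← Set.ncard_coe_finset]
    exact Set.ncard_le_ncard (fun γ hγ => h γ (Finset.mem_coe.mp hγ))
      ((Set.toFinite _).image c)
  choose x₀ hx₀ using hU.1
  by_cases hnew : ∃ j, j ∉ I ∧ ∃ w ∈ U j, c w ∉ CI
  · obtain ⟨j, hj, w, hw, hwC⟩ := hnew
    obtain ⟨e, he, v, hv, h1, h2⟩ := hnb (Function.update x₀ j w) (by
      intro i
      by_cases hij : i = j
      · subst hij; simpa using hw
      · rw [Function.update_of_ne hij]; exact hx₀ i)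
    refine ⟨e, he, v, hv, (min_le_left _ _).trans ?_⟩
    have h3 := h1 j hj
    rw [Function.update_self] at h3
    have h4 := hcard (insert (c w) CI) (e.erase v) (by
      intro γ hγ
      rcases Finset.mem_insert.mp hγ with rfl | hγ
      · exact h3
      · exact h2 γ hγ)
    rw [Finset.card_insert_of_notMem hwC] at h4
    omega
  · push Not at hnew
    obtain ⟨e, he, v, hv, h1, h2⟩ := hnb x₀ hx₀
    refine ⟨e, he, v, hv, (min_le_right _ _).trans ?_⟩
    apply aux_ceil _ _ _ hr
    have h5 : Finset.univ.biUnion (fun i => (U i).image c) ⊆ CI := by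
      intro γ hγ
      obtain ⟨i, _, hγ⟩ := Finset.mem_biUnion.mp hγ
      by_cases hi : i ∈ I
      · exact Finset.mem_biUnion.mpr ⟨i, hi, hγ⟩
      · obtain ⟨w, hw, rfl⟩ := Finset.mem_image.mp hγ
        exact hnew i hi w hw
    have h6 := aux_count hc hU Finset.univ
    have h7 := aux_sum Finset.univ B _ a hUa hB
    rw [Finset.univ_inter, Finset.card_univ, ZMod.card, hBc, mul_comm p a, ← hab] at h7
    exact (h7.trans h6).trans (Nat.mul_le_mul_left _
      ((Finset.card_le_card h5).trans (hcard CI _ h2)))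
end
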